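/- arXiv:math/0209196 — 3 statements merged into one kernel-verified Lean document; each statement's English description precedes it below -/
import Mathlib

section
/- Let (T,m) be a Noetherian local ring, R = T[x_1,…,x_n] a polynomial ring over T, and I = (x_1,…,x_n)R. Let f ∈ R be a homogeneous element and let C_f ⊆ T be the ideal generated by the (nonzero) coefficients of f. Then the support of H^n_I(R/fR) as an R-module equals the set of prime ideals Q of R containing I + C_f R. -/
open MvPolynomial

universe v u

section

open CategoryTheory Limits

lemma HomologicalComplex.homologyUnop_inv_naturality {V ι : Type*} [Category V] [HasZeroMorphisms V]
    {c : ComplexShape ι} {K L : HomologicalComplex Vᵒᵖ c} (ψ : K ⟶ L) (i : ι)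
    [K.HasHomology i] [L.HasHomology i] :
    (L.homologyUnop i).inv ≫ homologyMap ((unopFunctor V c).map ψ.op) i =
      (homologyMap ψ i).unop ≫ (K.homologyUnop i).inv := by
  have h := congrArg Quiver.Hom.unop (homologyOp_hom_naturality ((unopFunctor V c).map ψ.op) i)
  exact (Iso.inv_comp_eq (L.homologyUnop i)).2
    (((Iso.eq_comp_inv (K.homologyUnop i)).2 h.symm).trans (Category.assoc _ _ _))

lemma HomologicalComplex.exists_iCycles_eq {R : Type v} [CommRing R] {ι : Type*}
    {c : ComplexShape ι} (K : HomologicalComplex (ModuleCat.{v} R) c) (i j : ι) (hj : c.next i = j) (x : K.X i)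
    (hx : K.d i j x = 0) : ∃ z, K.iCycles i z = x := by
  refine ⟨K.liftCycles (ModuleCat.ofHom (LinearMap.toSpanSingleton R _ x)) j hj ?_ (1 : R), ?_⟩
  · ext
    simpa using hx
  · rw [← ConcreteCategory.comp_apply, liftCycles_i]
    exact one_smul R x

lemma HomologicalComplex.homologyπ_apply_eq_zero_iff {R : Type v} [CommRing R] {ι : Type*}
    {c : ComplexShape ι} (K : HomologicalComplex (ModuleCat.{v} R) c) (j i : ι) (hj : c.prev i = j)
    (z : K.cycles i) : K.homologyπ i z = 0 ↔ ∃ w, K.d j i w = K.iCycles i z := by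
  have h := (ShortComplex.moduleCat_exact_iff _).1
    (ShortComplex.exact_of_g_is_cokernel (ShortComplex.mk _ _ (K.toCycles_comp_homologyπ j i))
      (K.homologyIsCokernel j i hj))
  constructor
  · intro hz
    obtain ⟨w, hw⟩ := h z hz
    refine ⟨w, ?_⟩
    rw [← hw, ← K.toCycles_i j i]
    rfl
  · rintro ⟨w, hw⟩
    rw [← K.toCycles_i j i, ConcreteCategory.comp_apply] at hw
    rw [← (ModuleCat.mono_iff_injective (K.iCycles i)).1 inferInstance hw,
      ← ConcreteCategory.comp_apply, K.toCycles_comp_homologyπ]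
    rfl

namespace CategoryTheory.ProjectiveResolution
variable {R : Type v} [CommRing R] {C : Type u} [Category.{v} C] [Abelian C] [Linear R C]

variable (R) in
/-- The map of cochain complexes `Hom(P, Y) ⟶ Hom(P', Y)` induced by `φ : P' ⟶ P`. -/
noncomputable def linearYonedaMap {P P' : ChainComplex C ℕ} (φ : P' ⟶ P) (Y : C) :
    P.linearYonedaObj R Y ⟶ P'.linearYonedaObj R Y :=
  (HomologicalComplex.unopFunctor _ _).map
    (((((linearYoneda R C).obj Y).rightOp.mapHomologicalComplex _).map φ).op)

lemma isoExt_hom_naturality [EnoughProjectives C] {X' X : C} {P' : ProjectiveResolution X'}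
    {P : ProjectiveResolution X} {g : X' ⟶ X} (φ : Hom P' P g) (n : ℕ) (Y : C) :
    ((Ext R C n).map g.op).app Y ≫ (P'.isoExt n Y).hom =
      (P.isoExt n Y).hom ≫ HomologicalComplex.homologyMap (linearYonedaMap R φ.hom Y) n := by
  have h := congrArg Quiver.Hom.unop
    (isoLeftDerivedObj_inv_naturality g P' P φ.hom (by simpa using φ.hom_f_zero_comp_π_f_zero)
      ((linearYoneda R C).obj Y).rightOp n)
  have h2 := HomologicalComplex.homologyUnop_inv_naturality
    ((((linearYoneda R C).obj Y).rightOp.mapHomologicalComplex _).map φ.hom) n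
  exact (Category.assoc _ _ _).symm.trans <| (congrArg (· ≫ _) h).trans <|
    (Category.assoc _ _ _).trans <| (congrArg (_ ≫ ·) h2.symm).trans (Category.assoc _ _ _).symm

variable {X Y : C}

variable (R) in
/-- The `n`-cocycles of `Hom(P, Y)` are morphisms `P.X n ⟶ Y`. -/
noncomputable def cyclesInclusion (P : ChainComplex C ℕ) (n : ℕ) (Y : C) :
    (P.linearYonedaObj R Y).cycles n →ₗ[R] (P.X n ⟶ Y) :=
  ((P.linearYonedaObj R Y).iCycles n).hom

lemma d_comp_cyclesInclusion (P : ChainComplex C ℕ) (n : ℕ) (Y : C) (z) :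
    P.d (n + 1) n ≫ cyclesInclusion R P n Y z = 0 :=
  congr($((P.linearYonedaObj R Y).iCycles_d n (n+1)) z)

variable [HasExt.{v} C]

lemma extMk_zero_degree_eq_zero_iff (P : ProjectiveResolution X) (f : P.complex.X 0 ⟶ Y)
    (m : ℕ) (hm : 0 + 1 = m) (hf : P.complex.d m 0 ≫ f = 0) :
    P.extMk f m hm hf = 0 ↔ f = 0 := by
  simp only [← P.extEquivCohomologyClass.apply_eq_iff_eq,
    extEquivCohomologyClass_extMk, extEquivCohomologyClass_zero,
    CochainComplex.HomComplex.CohomologyClass.mk_eq_zero_iff]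
  rw [CochainComplex.HomComplex.Cocycle.toSingleMk_mem_coboundaries_iff _ _ _ _ _ 1 (by lia)]
  constructor
  · rintro ⟨g, hg⟩
    have : P.cochainComplex.d (-(0:ℕ)) 1 = 0 :=
      (CochainComplex.isZero_of_isStrictlyLE _ 0 _ (by lia)).eq_of_tgt _ _
    rw [this, zero_comp] at hg
    exact (cancel_epi _).1 (hg.symm.trans comp_zero.symm)
  · rintro rfl
    exact ⟨0, by simp⟩

variable (R) in
/-- The extension class of a cocycle with respect to a projective resolution. -/
noncomputable def cyclesToExt (P : ProjectiveResolution X) (n : ℕ) (Y : C) :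
    (P.complex.linearYonedaObj R Y).cycles n →ₗ[R] (Abelian.Ext X Y n) where
  toFun z := P.extMk (cyclesInclusion R P.complex n Y z) (n + 1) rfl
    (d_comp_cyclesInclusion P.complex n Y z)
  map_add' a b := by
    rw [add_extMk]; congr 1; exact map_add _ a b
  map_smul' r z := by
    rw [RingHom.id_apply, Abelian.Ext.smul_eq_comp_mk₀, extMk_comp_mk₀]; congr 1
    rw [map_smul, Linear.comp_smul, Category.comp_id]

lemma cyclesToExt_surjective (P : ProjectiveResolution X) (n : ℕ) (Y : C) :
    Function.Surjective (P.cyclesToExt R n Y) := by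
  intro α
  obtain ⟨f, hf, rfl⟩ := P.extMk_surjective α _ rfl
  obtain ⟨z, hz⟩ := (P.complex.linearYonedaObj R Y).exists_iCycles_eq n (n + 1) (by simp) f hf
  exact ⟨z, by subst hz; rfl⟩

lemma ker_cyclesToExt (P : ProjectiveResolution X) (n : ℕ) (Y : C) :
    LinearMap.ker (P.cyclesToExt R n Y) =
      LinearMap.ker ((P.complex.linearYonedaObj R Y).homologyπ n).hom := by
  ext z
  rw [LinearMap.mem_ker, LinearMap.mem_ker]
  cases n with
  | zero =>
    refine (extMk_zero_degree_eq_zero_iff P _ _ rfl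
      (d_comp_cyclesInclusion P.complex 0 Y z)).trans (Iff.trans ?_
     ((P.complex.linearYonedaObj R Y).homologyπ_apply_eq_zero_iff _ 0 rfl z).symm)
    rw [HomologicalComplex.shape _ _ _ (by simp)]
    exact ⟨fun h => ⟨0, h.symm⟩, fun ⟨w, h⟩ => h.symm⟩
  | succ n =>
    exact (extMk_eq_zero_iff P _ _ rfl (d_comp_cyclesInclusion P.complex (n + 1) Y z) n rfl).trans
      ((P.complex.linearYonedaObj R Y).homologyπ_apply_eq_zero_iff n (n+1) (by simp) z).symm

variable [EnoughProjectives C]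
variable (R) in
/-- The comparison of the two definitions of `Ext`, by means of a projective resolution. -/
noncomputable def extComparison (P : ProjectiveResolution X) (n : ℕ) (Y : C) :
   ((Ext R C n).obj (Opposite.op X)).obj Y ≃ₗ[R] (Abelian.Ext X Y n) :=
  (P.isoExt n Y).toLinearEquiv ≪≫ₗ (LinearMap.quotKerEquivOfSurjective _
    ((ModuleCat.epi_iff_surjective
      ((P.complex.linearYonedaObj R Y).homologyπ n)).1 inferInstance)).symm ≪≫ₗ
   Submodule.quotEquivOfEq _ _ (ker_cyclesToExt P n Y).symm ≪≫ₗ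
   LinearMap.quotKerEquivOfSurjective _ (P.cyclesToExt_surjective n Y)

lemma extComparison_apply (P : ProjectiveResolution X) (n : ℕ) (Y : C)
    (e : ((Ext R C n).obj (Opposite.op X)).obj Y) (z)
    (h : (P.isoExt n Y).hom e = ((P.complex.linearYonedaObj R Y).homologyπ n z)) :
    P.extComparison R n Y e = P.cyclesToExt R n Y z := by
  have : (LinearMap.quotKerEquivOfSurjective _
    ((ModuleCat.epi_iff_surjective
      ((P.complex.linearYonedaObj R Y).homologyπ n)).1 inferInstance)).symm
        ((P.isoExt n Y).hom e) = Submodule.Quotient.mk z := by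
    rw [LinearEquiv.symm_apply_eq]
    exact h
  exact congrArg (fun x => LinearMap.quotKerEquivOfSurjective _ (P.cyclesToExt_surjective n Y)
    (Submodule.quotEquivOfEq _ _ (ker_cyclesToExt P n Y).symm x)) this

lemma extComparison_naturality {X' X : C} {P' : ProjectiveResolution X'}
    {P : ProjectiveResolution X} {g : X' ⟶ X} (φ : Hom P' P g) (n : ℕ) (Y : C) (e : ((Ext R C n).obj (Opposite.op X)).obj Y) :
    P'.extComparison R n Y (((Ext R C n).map g.op).app Y e) =
     (Abelian.Ext.mk₀ g).comp (P.extComparison R n Y e) (zero_add n) := by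
  obtain ⟨z, hz⟩ := (ModuleCat.epi_iff_surjective
      ((P.complex.linearYonedaObj R Y).homologyπ n)).1 inferInstance ((P.isoExt n Y).hom e)
  have h1 : (P'.isoExt n Y).hom (((Ext R C n).map g.op).app Y e) =
    ((P'.complex.linearYonedaObj R Y).homologyπ n
      (HomologicalComplex.cyclesMap (linearYonedaMap R φ.hom Y) n z)) := by
    rw [← ConcreteCategory.comp_apply, isoExt_hom_naturality φ, ConcreteCategory.comp_apply, ← hz,
      ← ConcreteCategory.comp_apply, HomologicalComplex.homologyπ_naturality]
    rfl
  rw [extComparison_apply P n Y e z hz.symm, extComparison_apply P' n Y _ _ h1]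
  refine .trans ?_ (mk₀_comp_extMk _ (n + 1) rfl (d_comp_cyclesInclusion P.complex n Y z) φ).symm
  change P'.extMk _ (n + 1) rfl (d_comp_cyclesInclusion P'.complex n Y _) = _
  congr 1
  exact congr($(HomologicalComplex.cyclesMap_i (linearYonedaMap R φ.hom Y) n) z)

end CategoryTheory.ProjectiveResolution

variable {R : Type v} [CommRing R]

/-- The complex `R ⧸ J ⟶ R ⧸ J ⟶ R ⧸ (J ⊔ (y))` whose first map is multiplication by `y`. -/
abbrev quotientSMulShortComplex (J : Ideal R) (y : R) : ShortComplex (ModuleCat.{v} R) :=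
  ShortComplex.mk (y • 𝟙 (ModuleCat.of R (R ⧸ J)))
    (ModuleCat.ofHom (Submodule.factor (le_sup_left : J ≤ J ⊔ Ideal.span {y}))) <| by
  ext
  exact (Submodule.Quotient.mk_eq_zero _).2
    (Ideal.mul_mem_right _ _ (Ideal.mem_sup_right (Ideal.mem_span_singleton_self y)))

lemma quotientSMulShortComplex_shortExact {J : Ideal R} {y : R} (hy : ∀ g, y * g ∈ J → g ∈ J) :
    (quotientSMulShortComplex J y).ShortExact := by
  refine ModuleCat.shortComplex_shortExact _ ?_ ?_ (Submodule.factor_surjective le_sup_left)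
  · intro a
    obtain ⟨a, rfl⟩ := Submodule.Quotient.mk_surjective _ a
    constructor
    · intro h
      obtain ⟨u, hu, w, hw, rfl⟩ := Submodule.mem_sup.1 ((Submodule.Quotient.mk_eq_zero _).1 h)
      obtain ⟨c, rfl⟩ := Ideal.mem_span_singleton'.1 hw
      refine ⟨Submodule.Quotient.mk c, ?_⟩
      refine (Submodule.Quotient.eq J).2 ?_
      change y * c - (u + c * y) ∈ J
      rw [mul_comm, sub_add_cancel_right]
      exact J.neg_mem hu
    · rintro ⟨b, hb⟩
      rw [← hb]
      exact congr($((quotientSMulShortComplex J y).zero) b)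
  · refine (injective_iff_map_eq_zero _).2 fun a ha => ?_
    obtain ⟨a, rfl⟩ := Submodule.Quotient.mk_surjective _ a
    exact (Submodule.Quotient.mk_eq_zero _).2 (hy a ((Submodule.Quotient.mk_eq_zero _).1 ha))

/-- The ideals `J t` form a decreasing sequence, the modules `R ⧸ J t` have projective dimension at
most `k`, and composition with the classes `κ t` identifies `M ⧸ J t • M` with `Ext (R ⧸ J t) M k`,
in such a way that the transition maps become multiplication by `P`. -/
structure IsTopExtSystem (J : ℕ → Ideal R) (hJ : ∀ t, J (t + 1) ≤ J t) (P : R) (k : ℕ)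
   (κ : ∀ t, Abelian.Ext (ModuleCat.of R (R ⧸ J t)) (ModuleCat.of R R) k) : Prop where
  exists_comp_eq (t : ℕ) {M : ModuleCat.{v} R} (α : Abelian.Ext (ModuleCat.of R (R ⧸ J t)) M k) :
    ∃ φ : ModuleCat.of R R ⟶ M, (κ t).comp (Abelian.Ext.mk₀ φ) (add_zero k) = α
  comp_eq_zero_iff (t : ℕ) {M : ModuleCat.{v} R} (φ : ModuleCat.of R R ⟶ M) :
    (κ t).comp (Abelian.Ext.mk₀ φ) (add_zero k) = 0 ↔ φ.hom 1 ∈ J t • (⊤ : Submodule R M)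
  factor_comp (t : ℕ) :
    (Abelian.Ext.mk₀ (ModuleCat.ofHom (Submodule.factor (hJ t)))).comp (κ t) (zero_add k) =
      P • κ (t + 1)
  hasProjectiveDimensionLT (t : ℕ) :
    HasProjectiveDimensionLT (ModuleCat.of R (R ⧸ J t)) (k + 1)

lemma IsTopExtSystem.comp_eq_comp_iff {J : ℕ → Ideal R} {hJ : ∀ t, J (t + 1) ≤ J t} {P : R} {k : ℕ}
    {κ : ∀ t, Abelian.Ext (ModuleCat.of R (R ⧸ J t)) (ModuleCat.of R R) k}
    (h : IsTopExtSystem J hJ P k κ) (t : ℕ) {M : ModuleCat.{v} R} (φ ψ : ModuleCat.of R R ⟶ M) :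
    (κ t).comp (Abelian.Ext.mk₀ φ) (add_zero k) = (κ t).comp (Abelian.Ext.mk₀ ψ) (add_zero k) ↔
      φ.hom 1 - ψ.hom 1 ∈ J t • (⊤ : Submodule R M) := by
  rw [← sub_eq_zero, sub_eq_add_neg, ← Abelian.Ext.comp_neg, ← Abelian.Ext.comp_add,
    ← Abelian.Ext.mk₀_neg, ← Abelian.Ext.mk₀_add, h.comp_eq_zero_iff, ← sub_eq_add_neg]
  rfl

lemma isTopExtSystem_bot : IsTopExtSystem (fun _ => (⊥ : Ideal R)) (fun _ => le_rfl) 1 0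
    (fun _ => Abelian.Ext.mk₀ (ModuleCat.ofHom (Submodule.quotEquivOfEqBot ⊥ rfl).toLinearMap)) where
  exists_comp_eq t M α := by
    obtain ⟨ψ, rfl⟩ := Abelian.Ext.homEquiv₀.symm.surjective α
    refine ⟨ModuleCat.ofHom (Submodule.mkQ ⊥) ≫ ψ, ?_⟩
    rw [Abelian.Ext.mk₀_comp_mk₀]
    refine congrArg Abelian.Ext.mk₀ ?_
    ext
    rfl
  comp_eq_zero_iff t M φ := by
    rw [Abelian.Ext.mk₀_comp_mk₀, Abelian.Ext.mk₀_eq_zero_iff, Submodule.bot_smul,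
      Submodule.mem_bot]
    constructor
    · intro h
      exact congr($h (Submodule.Quotient.mk 1))
    · intro h
      ext
      exact h
  factor_comp t := by
    rw [one_smul, Abelian.Ext.mk₀_comp_mk₀]
    refine congrArg Abelian.Ext.mk₀ ?_
    ext
    rfl
  hasProjectiveDimensionLT t := by
    have : Projective (ModuleCat.of R (R ⧸ (⊥ : Ideal R))) :=
      Projective.of_iso (LinearEquiv.toModuleIso (Submodule.quotEquivOfEqBot (⊥ : Ideal R) rfl)).symm
        inferInstance
    infer_instance

/-- The morphism of complexes which is induced by an inclusion `J' ≤ J` in degrees 2 and 3, and by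
`z` times the projection in degree 1. -/
abbrev quotientSMulShortComplexMap {J J' : Ideal R} (hJ : J' ≤ J) {y y' z : R} (hy : y' = z * y)
    (hJy : J' ⊔ Ideal.span {y'} ≤ J ⊔ Ideal.span {y}) :
    quotientSMulShortComplex J' y' ⟶ quotientSMulShortComplex J y where
  τ₁ := z • ModuleCat.ofHom (Submodule.factor hJ)
  τ₂ := ModuleCat.ofHom (Submodule.factor hJ)
  τ₃ := ModuleCat.ofHom (Submodule.factor hJy)
  comm₁₂ := by
    ext
    simp [hy, mul_smul, smul_comm y z]
  comm₂₃ := by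
    ext
    simp

lemma IsTopExtSystem.exists_succ {J : ℕ → Ideal R} {hJ : ∀ t, J (t + 1) ≤ J t} {P : R} {k : ℕ}
    {κ : ∀ t, Abelian.Ext (ModuleCat.of R (R ⧸ J t)) (ModuleCat.of R R) k}
    (h : IsTopExtSystem J hJ P k κ) (y : ℕ → R) (z : R) (hyz : ∀ t, y (t + 1) = z * y t)
    (hy : ∀ t g, y t * g ∈ J t → g ∈ J t)
    (hJ' : ∀ t, J (t + 1) ⊔ Ideal.span {y (t + 1)} ≤ J t ⊔ Ideal.span {y t}) :
    ∃ κ', IsTopExtSystem (fun t => J t ⊔ Ideal.span {y t}) hJ' (z * P) (1 + k) κ' := by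
  have S t := quotientSMulShortComplex_shortExact (hy t)
  refine ⟨fun t => (S t).extClass.comp (κ t) rfl, fun t M α => ?_, fun t M φ => ?_, fun t => ?_,
    fun t => ?_⟩
  · have := h.hasProjectiveDimensionLT t
    obtain ⟨β, hβ⟩ := Abelian.Ext.contravariant_sequence_exact₃ (S t) M α
      (Abelian.Ext.eq_zero_of_hasProjectiveDimensionLT (X := ModuleCat.of R (R ⧸ J t))
        _ (k + 1) (by lia)) rfl
    obtain ⟨φ, rfl⟩ := h.exists_comp_eq t β
    exact ⟨φ, (Abelian.Ext.comp_assoc _ _ _ _ _ (by lia)).trans hβ⟩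
  · rw [Abelian.Ext.comp_assoc _ _ _ _ (add_zero k) (by lia)]
    have key (ψ : ModuleCat.of R R ⟶ M) :
        (Abelian.Ext.mk₀ (quotientSMulShortComplex (J t) (y t)).f).comp
          ((κ t).comp (Abelian.Ext.mk₀ ψ) (add_zero k)) (zero_add k) =
          (κ t).comp (Abelian.Ext.mk₀ (y t • ψ)) (add_zero k) := by
      refine (congrArg (fun u => Abelian.Ext.comp u _ (zero_add k))
        (Abelian.Ext.mk₀_smul (y t) (𝟙 _))).trans ?_
      rw [Abelian.Ext.mk₀_smul, Abelian.Ext.comp_smul]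
      refine (Abelian.Ext.smul_comp _ _ _ _).trans (congrArg _ (Abelian.Ext.mk₀_id_comp _))
    constructor
    · intro h0
      obtain ⟨β, hβ⟩ := Abelian.Ext.contravariant_sequence_exact₁ (S t) M _ _ h0
      obtain ⟨ψ, rfl⟩ := h.exists_comp_eq t β
      have h1 := (h.comp_eq_comp_iff t φ (y t • ψ)).1 (by rw [← hβ, ← key])
      have h2 : φ.hom 1 = (φ.hom 1 - (y t • ψ).hom 1) + y t • ψ.hom 1 := (sub_add_cancel _ _).symm
      rw [h2, Submodule.sup_smul]
      exact Submodule.add_mem_sup h1 (Submodule.smul_mem_smul (Ideal.mem_span_singleton_self _)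
        trivial)
    · intro h0
      rw [Submodule.sup_smul, Submodule.ideal_span_singleton_smul] at h0
      obtain ⟨u, hu, w, hw, huw⟩ := Submodule.mem_sup.1 h0
      obtain ⟨m, -, rfl⟩ := hw
      let ψ : ModuleCat.of R R ⟶ M := ModuleCat.ofHom (LinearMap.toSpanSingleton R M m)
      have h1 := (h.comp_eq_comp_iff t φ (y t • ψ)).2 (by
        have : (y t • ψ).hom 1 = y t • ((1 : R) • m) := rfl
        rw [this, one_smul, ← huw]
        simpa using hu)
      rw [h1, ← key]
      exact (S t).extClass_comp_assoc _
  · have hτ := (S (t + 1)).extClass_naturality (S t)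
      (quotientSMulShortComplexMap (hJ t) (hyz t) (hJ' t))
    refine (Abelian.Ext.comp_assoc _ _ _ (zero_add 1) _ (by lia)).symm.trans ?_
    refine (congrArg (fun u => Abelian.Ext.comp u (κ t) rfl) hτ.symm).trans ?_
    refine (Abelian.Ext.comp_assoc _ _ _ _ (zero_add k) (by lia)).trans ?_
    rw [Abelian.Ext.mk₀_smul, Abelian.Ext.smul_comp, h.factor_comp, smul_smul,
      Abelian.Ext.comp_smul]
  · have := h.hasProjectiveDimensionLT t
    rw [add_comm 1 k]
    refine (S t).hasProjectiveDimensionLT_X₃ (k + 1) this ?_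
    exact hasProjectiveDimensionLT_of_ge _ (k + 1) _ (by lia)

/-- The ideal generated by the `t`-th powers of the elements `x i` for `i ∈ s`. -/
def spanPow {ι : Type*} (x : ι → R) (s : Set ι) (t : ℕ) : Ideal R :=
  Ideal.span ((fun i => x i ^ t) '' s)

lemma spanPow_succ_le {ι : Type*} (x : ι → R) (s : Set ι) (t : ℕ) :
    spanPow x s (t + 1) ≤ spanPow x s t := by
  refine Ideal.span_le.2 ?_
  rintro _ ⟨i, hi, rfl⟩
  exact Ideal.mem_of_dvd _ (pow_dvd_pow _ t.le_succ) (Ideal.subset_span ⟨i, hi, rfl⟩)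

lemma spanPow_insert {ι : Type*} (x : ι → R) (s : Set ι) (i : ι) (t : ℕ) :
    spanPow x (insert i s) t = spanPow x s t ⊔ Ideal.span {x i ^ t} := by
  rw [spanPow, Set.image_insert_eq, Ideal.span_insert, sup_comm]
  rfl

lemma exists_isTopExtSystem_spanPow {ι : Type*} [DecidableEq ι] (x : ι → R)
    (hx : ∀ (s : Set ι), ∀ i ∉ s, ∀ t g, x i ^ t * g ∈ spanPow x s t → g ∈ spanPow x s t)
    (s : Finset ι) :
    ∃ κ, IsTopExtSystem (spanPow x s) (spanPow_succ_le x s) (∏ i ∈ s, x i) s.card κ := by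
  have congr_aux {J J' : ℕ → Ideal R} {hJ : ∀ t, J (t + 1) ≤ J t} {P P' : R} {k k' : ℕ}
      (h : ∃ κ, IsTopExtSystem J hJ P k κ) (hJJ : J' = J) (hP : P' = P) (hk : k' = k) :
      ∃ κ, IsTopExtSystem J' (fun t => by rw [hJJ]; exact hJ t) P' k' κ := by
    subst hJJ hP hk
    exact h
  induction s using Finset.induction_on with
  | empty =>
    exact congr_aux ⟨_, isTopExtSystem_bot⟩ (by ext1 t; simp [spanPow]) rfl rfl
  | insert i s hi ih =>
    obtain ⟨κ, hκ⟩ := ih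
    refine congr_aux (hκ.exists_succ (fun t => x i ^ t) (x i) (fun t => pow_succ' _ _)
      (hx s i (by simpa using hi))
      (fun t => by simpa only [spanPow_insert] using spanPow_succ_le x (insert i s) t)) ?_
      (Finset.prod_insert hi) ((Finset.card_insert_of_notMem hi).trans (add_comm _ _))
    ext1 t
    rw [Finset.coe_insert, spanPow_insert]

/-- A decreasing sequence of ideals, as a functor. -/
def idealSequence (J : ℕ → Ideal R) (hJ : ∀ t, J (t + 1) ≤ J t) : ℕᵒᵖ ⥤ Ideal R where
  obj t := J t.unop
  map w := homOfLE (antitone_nat_of_succ_le hJ (leOfHom w.unop))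

namespace IsTopExtSystem

variable {J : ℕ → Ideal R} {hJ : ∀ t, J (t + 1) ≤ J t} {P : R} {k : ℕ}
    {κ : ∀ t, Abelian.Ext (ModuleCat.of R (R ⧸ J t)) (ModuleCat.of R R) k}

lemma factor_comp_add (h : IsTopExtSystem J hJ P k κ) (s j : ℕ) (hsj : J (s + j) ≤ J s) :
    (Abelian.Ext.mk₀ (ModuleCat.ofHom (Submodule.factor hsj))).comp (κ s) (zero_add k) =
      P ^ j • κ (s + j) := by
  induction j with
  | zero =>
    have : ModuleCat.ofHom (Submodule.factor hsj) = 𝟙 (ModuleCat.of R (R ⧸ J s)) := by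
      ext; rfl
    rw [pow_zero, one_smul]
    exact (congrArg (fun f => (Abelian.Ext.mk₀ f).comp (κ s) (zero_add k)) this).trans
      (Abelian.Ext.mk₀_id_comp _)
  | succ j ih =>
    have h2 : J (s + j) ≤ J s := antitone_nat_of_succ_le hJ (Nat.le_add_right s j)
    have : ModuleCat.ofHom (Submodule.factor hsj) =
        ModuleCat.ofHom (Submodule.factor (hJ (s + j))) ≫
          ModuleCat.ofHom (Submodule.factor h2) := by
      ext; rfl
    have h3 := congrArg (fun f => (Abelian.Ext.mk₀ f).comp (κ s) (zero_add k)) this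
    refine h3.trans ?_
    rw [← Abelian.Ext.mk₀_comp_mk₀_assoc, ih, Abelian.Ext.comp_smul, h.factor_comp, smul_smul,
      ← pow_succ]
    rfl

variable (κ) in
/-- The map `M → Ext (R ⧸ J t) M k` which sends `m` to the composition of `κ t` with `1 ↦ m`. -/
noncomputable def compMap (M : ModuleCat.{v} R) (t : ℕ) :
    M →ₗ[R] Abelian.Ext (ModuleCat.of R (R ⧸ J t)) M k where
  toFun m := (κ t).comp (Abelian.Ext.mk₀ (ModuleCat.ofHom (LinearMap.toSpanSingleton R M m)))
    (add_zero k)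
  map_add' a b := by
    rw [LinearMap.toSpanSingleton_add, ModuleCat.ofHom_add, Abelian.Ext.mk₀_add,
      Abelian.Ext.comp_add]
  map_smul' r a := by
    have : ModuleCat.ofHom (LinearMap.toSpanSingleton R M (r • a)) =
        r • ModuleCat.ofHom (LinearMap.toSpanSingleton R M a) := by
      rw [LinearMap.toSpanSingleton_smul]
      rfl
    rw [this, Abelian.Ext.mk₀_smul, Abelian.Ext.comp_smul]
    rfl

lemma compMap_surjective (h : IsTopExtSystem J hJ P k κ) (M : ModuleCat.{v} R) (t : ℕ) :
    Function.Surjective (compMap κ M t) := by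
  intro α
  obtain ⟨φ, rfl⟩ := h.exists_comp_eq t α
  have : ModuleCat.ofHom (LinearMap.toSpanSingleton R M (φ.hom 1)) = φ := by
    ext
    simp
  exact ⟨φ.hom 1, congrArg (fun f => (κ t).comp (Abelian.Ext.mk₀ f) (add_zero k)) this⟩

lemma compMap_eq_zero_iff (h : IsTopExtSystem J hJ P k κ) (M : ModuleCat.{v} R) (t : ℕ) (m : M) :
    compMap κ M t m = 0 ↔ m ∈ J t • (⊤ : Submodule R M) := by
  refine (h.comp_eq_zero_iff t _).trans ?_
  simp

variable (κ) in
/-- The map from `M` to the component of index `t` of the diagram defining local cohomology. -/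
noncomputable def toDiagram (M : ModuleCat.{v} R) (t : ℕ) :
    M →ₗ[R] ((localCohomology.diagram (idealSequence J hJ) k).obj (.op (.op t))).obj M :=
  ((ProjectiveResolution.of (ModuleCat.of R (R ⧸ J t))).extComparison R k M).symm.toLinearMap ∘ₗ
    compMap κ M t

lemma diagram_map_toDiagram (h : IsTopExtSystem J hJ P k κ) (M : ModuleCat.{v} R) (s j : ℕ)
    (w : Opposite.op (Opposite.op s) ⟶ Opposite.op (Opposite.op (s + j))) (m : M) :
    ((localCohomology.diagram (idealSequence J hJ) k).map w).app M (toDiagram κ M s m) =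
     toDiagram κ M (s + j) (P ^ j • m) := by
  have hsj : J (s + j) ≤ J s := antitone_nat_of_succ_le hJ (Nat.le_add_right s j)
  let Q t := ProjectiveResolution.of (ModuleCat.of R (R ⧸ J t))
  let g : ModuleCat.of R (R ⧸ J (s + j)) ⟶ ModuleCat.of R (R ⧸ J s) :=
    ModuleCat.ofHom (Submodule.factor hsj)
  let Φ : ProjectiveResolution.Hom (Q (s + j)) (Q s) g :=
    ⟨ProjectiveResolution.lift g _ _,
      (ProjectiveResolution.lift_commutes_zero g _ _).trans (by simp)⟩
  refine (LinearEquiv.eq_symm_apply ((Q (s + j)).extComparison R k M)).2 ?_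
  refine (ProjectiveResolution.extComparison_naturality Φ k M (toDiagram κ M s m)).trans ?_
  refine (congrArg (fun e => (Abelian.Ext.mk₀ g).comp e (zero_add k))
    (LinearEquiv.apply_symm_apply ((Q s).extComparison R k M) (compMap κ M s m))).trans ?_
  refine (Abelian.Ext.comp_assoc _ _ _ (zero_add k) (add_zero k) (by lia)).symm.trans ?_
  refine (congrArg (fun e => Abelian.Ext.comp e _ (add_zero k))
    (h.factor_comp_add s j hsj)).trans ?_
  refine (Abelian.Ext.smul_comp _ _ _ _).trans ?_
  exact (map_smul (compMap κ M (s + j)) _ _).symm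

end IsTopExtSystem

/-- A module `H` which is the direct limit of the quotients `M ⧸ J t • M` along multiplication by
`P`, presented by maps `σ t : M → H`. -/
structure IsTopLimit (J : ℕ → Ideal R) (P : R) {M H : Type*} [AddCommGroup M] [Module R M]
    [AddCommGroup H] [Module R H] (σ : ℕ → M →ₗ[R] H) : Prop where
  exists_eq (h : H) : ∃ t m, σ t m = h
  apply_smul (t : ℕ) (m : M) : σ (t + 1) (P • m) = σ t m
  apply_eq_zero_iff (t : ℕ) (m : M) :
    σ t m = 0 ↔ ∃ j, P ^ j • m ∈ J (t + j) • (⊤ : Submodule R M)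

lemma IsTopExtSystem.exists_isTopLimit {J : ℕ → Ideal R} {hJ : ∀ t, J (t + 1) ≤ J t} {P : R} {k : ℕ}
    {κ : ∀ t, Abelian.Ext (ModuleCat.of R (R ⧸ J t)) (ModuleCat.of R R) k}
    (h : IsTopExtSystem J hJ P k κ) (M : ModuleCat.{v} R) :
    ∃ σ : ℕ → M →ₗ[R] (localCohomology.ofDiagram.{v, 0} (idealSequence J hJ) k).obj M,
      IsTopLimit J P σ := by
  let F := localCohomology.diagram (idealSequence J hJ) k
  have hF := localCohomology.hasColimitDiagram.{v, 0} (idealSequence J hJ) k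
  have : PreservesFilteredColimitsOfSize.{0, 0} (forget (ModuleCat.{v} R)) :=
    preservesFilteredColimitsOfSize_shrink.{0, v, 0, v} _
  let E := (evaluation (ModuleCat.{v} R) (ModuleCat.{v} R)).obj M
  let hc : IsColimit (E.mapCocone (colimit.cocone F)) :=
    isColimitOfPreserves E (colimit.isColimit F)
  let ι (t : ℕ) : (F.obj (.op (.op t))).obj M ⟶
      (localCohomology.ofDiagram.{v, 0} (idealSequence J hJ) k).obj M :=
    (E.mapCocone (colimit.cocone F)).ι.app (.op (.op t))
  have hzero (t : ℕ) (m : M) : IsTopExtSystem.toDiagram (hJ := hJ) κ M t m = 0 ↔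
      m ∈ J t • (⊤ : Submodule R M) :=
    (LinearEquiv.map_eq_zero_iff ((ProjectiveResolution.of
      (ModuleCat.of R (R ⧸ J t))).extComparison R k M).symm).trans (h.compMap_eq_zero_iff M t m)
  have hw (s j : ℕ) (m : M) : ι (s + j) (IsTopExtSystem.toDiagram κ M (s + j) (P ^ j • m)) =
      ι s (IsTopExtSystem.toDiagram κ M s m) := by
    let w : Opposite.op (Opposite.op s) ⟶ Opposite.op (Opposite.op (s + j)) :=
      (homOfLE (Nat.le_add_right s j)).op.op
    rw [← h.diagram_map_toDiagram M s j w m]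
    exact congr($((E.mapCocone (colimit.cocone F)).w w) (IsTopExtSystem.toDiagram κ M s m))
  refine ⟨fun t => (ι t).hom ∘ₗ IsTopExtSystem.toDiagram κ M t, fun x => ?_, fun t m => ?_,
    fun t m => ?_⟩
  · obtain ⟨⟨⟨t⟩⟩, y, hy⟩ := Concrete.isColimit_exists_rep _ hc x
    obtain ⟨m, hm⟩ := (((ProjectiveResolution.of
      (ModuleCat.of R (R ⧸ J t))).extComparison R k M).symm.surjective.comp
        (h.compMap_surjective M t)) y
    exact ⟨t, m, (congrArg (ι t) hm).trans hy⟩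
  · have := hw t 1 m
    rw [pow_one] at this
    exact this
  · constructor
    · intro h0
      obtain ⟨⟨⟨u⟩⟩, f, g, hfg⟩ := (Concrete.isColimit_rep_eq_iff_exists _ hc
        (IsTopExtSystem.toDiagram κ M t m) (0 : (F.obj (.op (.op t))).obj M)).1
          (h0.trans (map_zero _).symm)
      obtain ⟨j, rfl⟩ := Nat.exists_eq_add_of_le (leOfHom f.unop.unop)
      refine ⟨j, (hzero _ _).1 ?_⟩
      rw [← h.diagram_map_toDiagram M t j f m]
      exact hfg.trans (map_zero _)
    · rintro ⟨j, hj⟩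
      refine (hw t j m).symm.trans ?_
      rw [(hzero _ _).2 hj, map_zero]

/-- A decreasing sequence of ideals whose radicals contain `I`, as a functor to the category of such
ideals. -/
def idealSequenceToSelfLERadical (J : ℕ → Ideal R) (hJ : ∀ t, J (t + 1) ≤ J t) (I : Ideal R)
    (hI : ∀ t, I ≤ (J t).radical) : ℕᵒᵖ ⥤ localCohomology.SelfLERadical I :=
  ObjectProperty.lift _ (idealSequence J hJ) fun t => hI t.unop

open localCohomology in
lemma idealSequenceToSelfLERadical_initial [IsNoetherianRing R] (J : ℕ → Ideal R)
    (hJ : ∀ t, J (t + 1) ≤ J t) (I : Ideal R) (hI : ∀ t, I ≤ (J t).radical)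
    (hJI : ∀ k, ∃ t, J t ≤ I ^ k) : (idealSequenceToSelfLERadical J hJ I hI).Initial where
  out J' := by
    apply +allowSynthFailures zigzag_isConnected
    · obtain ⟨k, hk⟩ := Ideal.exists_pow_le_of_le_radical_of_fg J'.2 (IsNoetherian.noetherian I)
      obtain ⟨t, ht⟩ := hJI k
      exact ⟨CostructuredArrow.mk (⟨⟨⟨ht.trans hk⟩⟩⟩ :
        (idealSequenceToSelfLERadical J hJ I hI).obj (.op t) ⟶ J')⟩
    · intro j1 j2
      apply Relation.ReflTransGen.single
      rcases le_total j1.left.unop j2.left.unop with h | h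
      · right; exact ⟨CostructuredArrow.homMk (homOfLE h).op rfl⟩
      · left; exact ⟨CostructuredArrow.homMk (homOfLE h).op rfl⟩

lemma nonempty_localCohomology_iso_ofDiagram [IsNoetherianRing R] (J : ℕ → Ideal R)
    (hJ : ∀ t, J (t + 1) ≤ J t) (I : Ideal R) (hI : ∀ t, I ≤ (J t).radical)
    (hJI : ∀ k, ∃ t, J t ≤ I ^ k) (k : ℕ) :
    Nonempty (localCohomology.ofDiagram.{v, 0} (idealSequence J hJ) k ≅ localCohomology I k) := by
  have := idealSequenceToSelfLERadical_initial J hJ I hI hJI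
  have := localCohomology.hasColimitDiagram.{v, 0} (idealSequence J hJ) k
  have := localCohomology.hasColimitDiagram.{v, 0}
    (idealSequenceToSelfLERadical J hJ I hI ⋙ localCohomology.selfLERadicalDiagram I) k
  exact ⟨HasColimit.isoOfNatIso (Iso.refl _) ≪≫
    localCohomology.isoOfFinal.{v, v, 0} (idealSequenceToSelfLERadical J hJ I hI)
      (localCohomology.selfLERadicalDiagram I) k ≪≫ localCohomology.isoSelfLERadical I k⟩

end

section
variable {T M : Type*} [CommRing T] [AddCommGroup M] [Module T M]

/-- The saturation of a submodule `N` with respect to the complement of a prime ideal `p`: the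
preimage of the localization `N_p` in `M`. -/
def primeSaturation (p : Ideal T) [p.IsPrime] (N : Submodule T M) : Submodule T M where
  carrier := {m | ∃ s ∉ p, s • m ∈ N}
  add_mem' := by
    rintro a b ⟨s, hs, hsa⟩ ⟨t, ht, htb⟩
    refine ⟨s * t, ‹p.IsPrime›.mul_notMem hs ht, ?_⟩
    rw [smul_add]
    refine N.add_mem ?_ ?_
    · rw [mul_comm, mul_smul]
      exact N.smul_mem _ hsa
    · rw [mul_smul]
      exact N.smul_mem _ htb
  zero_mem' := ⟨1, p.one_notMem, by simp⟩
  smul_mem' := by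
    rintro r a ⟨s, hs, hsa⟩
    refine ⟨s, hs, ?_⟩
    rw [smul_comm]
    exact N.smul_mem _ hsa

lemma mem_primeSaturation {p : Ideal T} [p.IsPrime] {N : Submodule T M} {m : M} :
    m ∈ primeSaturation p N ↔ ∃ s ∉ p, s • m ∈ N := Iff.rfl

lemma le_primeSaturation (p : Ideal T) [p.IsPrime] (N : Submodule T M) :
    N ≤ primeSaturation p N :=
  fun m hm => ⟨1, p.one_notMem, by simpa using hm⟩

lemma mem_primeSaturation_of_smul_mem {p : Ideal T} [hp : p.IsPrime] {N : Submodule T M} {s : T}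
    (hs : s ∉ p) {m : M} (h : s • m ∈ primeSaturation p N) : m ∈ primeSaturation p N := by
  obtain ⟨t, ht, htm⟩ := h
  exact ⟨t * s, hp.mul_notMem ht hs, by rwa [mul_smul]⟩

lemma exists_smul_mem_of_fg_of_le_primeSaturation {p : Ideal T} [hp : p.IsPrime]
    {L N : Submodule T M} (hL : L.FG) (h : L ≤ primeSaturation p N) :
    ∃ s ∉ p, ∀ m ∈ L, s • m ∈ N := by
  classical
  obtain ⟨S, rfl⟩ := hL
  choose! s hs hsm using fun m (hm : m ∈ S) => h (Submodule.subset_span hm)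
  refine ⟨∏ m ∈ S, s m, hp.prod_mem_iff.not.2 (by simpa using hs), fun m hm => ?_⟩
  induction hm using Submodule.span_induction with
  | mem m hm =>
    rw [← Finset.prod_erase_mul _ _ hm, mul_smul]
    exact N.smul_mem _ (hsm m hm)
  | zero => simp
  | add a b _ _ ha hb =>
    rw [smul_add]
    exact N.add_mem ha hb
  | smul r a _ ha =>
    rw [smul_comm]
    exact N.smul_mem _ ha

/-- A form of Nakayama's lemma at the prime `p`. -/
lemma le_primeSaturation_bot_of_le_primeSaturation_smul {p : Ideal T} [hp : p.IsPrime]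
    {L : Submodule T M} (hL : L.FG) (h : L ≤ primeSaturation p (p • L)) :
    L ≤ primeSaturation p ⊥ := by
  obtain ⟨s, hs, hsL⟩ := exists_smul_mem_of_fg_of_le_primeSaturation hL h
  have : Module.Finite T L := Module.Finite.iff_fg.2 hL
  obtain ⟨q, hq, -, hqp, hq0⟩ :=
    LinearMap.exists_monic_and_natDegree_eq_and_coeff_mem_pow_and_aeval_eq_zero T
      (algebraMap T (Module.End T L) s) p (by
        rintro _ ⟨m, rfl⟩
        exact (Submodule.mem_smul_top_iff p L _).2 (hsL m m.2))
  rw [Polynomial.aeval_algebraMap_apply_eq_algebraMap_eval] at hq0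
  refine fun m hm => ⟨q.eval s, fun hqs => hs ?_, congr(($hq0 ⟨m, hm⟩ : M))⟩
  rw [hq.as_sum, Polynomial.eval_add, Polynomial.eval_finsetSum] at hqs
  simp only [Polynomial.eval_pow, Polynomial.eval_X, Polynomial.eval_mul, Polynomial.eval_C] at hqs
  refine hp.mem_of_pow_mem _ ((p.add_mem_iff_left (p.sum_mem fun i hi => ?_)).1 hqs)
  exact p.mul_mem_right _ (Ideal.pow_le_self (Nat.sub_ne_zero_of_lt (Finset.mem_range.1 hi))
    (hqp i))
end

section
variable {σ T M : Type*} [CommRing T] [AddCommGroup M] [Module T M]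

open scoped MonomialOrder in
/-- Suppose that the family `w` is annihilated by the homogeneous polynomial `f`, acting by
contraction. At a prime which does not contain all coefficients of `f`, every `w e` vanishes. -/
lemma mem_primeSaturation_bot_of_contraction_eq_zero [Finite σ] {f : MvPolynomial σ T} {n : ℕ}
    (hf : f.IsHomogeneous n) {p : Ideal T} [hp : p.IsPrime] {a₀ : σ →₀ ℕ} (ha₀ : coeff a₀ f ∉ p)
    (w : (σ →₀ ℕ) → M)
    (hw : ∀ e, ∑ b ∈ f.support with b ≤ e, coeff b f • w (e - b) = 0) (e : σ →₀ ℕ) :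
    w e ∈ primeSaturation p (⊥ : Submodule T M) := by
  classical
  obtain ⟨_, _⟩ := exists_wellFoundedLT σ
  have : WellFoundedGT σ := Finite.to_wellFoundedGT
  let ord : MonomialOrder σ := MonomialOrder.lex
  obtain ⟨a, ha, hamin⟩ := (InvImage.wf ord.toSyn wellFounded_lt).has_min
    {a | coeff a f ∉ p} ⟨a₀, ha₀⟩
  have hdeg (b) (hb : b ∈ f.support) : b.degree = n := by
    by_contra h
    exact mem_support_iff.1 hb (hf.coeff_eq_zero h)
  have ha0 : a ∈ f.support := mem_support_iff.2 fun h => ha (h ▸ p.zero_mem)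
  let L := Submodule.span T (w '' {e' | e'.degree = e.degree})
  have hL : L.FG := Submodule.fg_span ((Finsupp.finite_of_degree_eq e.degree).image w)
  refine le_primeSaturation_bot_of_le_primeSaturation_smul hL (Submodule.span_le.2 ?_)
    (Submodule.subset_span ⟨e, rfl, rfl⟩)
  rintro _ ⟨e', he', rfl⟩
  induction e' using (InvImage.wf ord.toSyn wellFounded_lt).induction with
  | _ e' ih
  refine mem_primeSaturation_of_smul_mem ha ?_
  have h := hw (e' + a)
  rw [← Finset.add_sum_erase _ _ (Finset.mem_filter.2 ⟨ha0, le_add_self⟩),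
    add_tsub_cancel_right] at h
  rw [eq_neg_of_add_eq_zero_left h]
  refine Submodule.neg_mem _ (Submodule.sum_mem _ fun b hb => ?_)
  simp only [Finset.mem_erase, Finset.mem_filter] at hb
  obtain ⟨hba, hbf, hbe⟩ := hb
  have hd : (e' + a - b).degree = e.degree := by
    have := congrArg Finsupp.degree (tsub_add_cancel_of_le hbe)
    rw [map_add, map_add, hdeg b hbf, hdeg a ha0, he'] at this
    lia
  rcases lt_trichotomy (ord.toSyn b) (ord.toSyn a) with hlt | heq | hlt
  · have hbp : coeff b f ∈ p := not_not.1 fun h => hamin b h hlt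
    exact le_primeSaturation _ _ (Submodule.smul_mem_smul hbp (Submodule.subset_span ⟨_, hd, rfl⟩))
  · exact absurd (ord.toSyn.injective heq) hba
  · refine Submodule.smul_mem _ _ (ih _ ?_ hd)
    change ord.toSyn _ < ord.toSyn _
    have := congrArg ord.toSyn (tsub_add_cancel_of_le hbe)
    rw [map_add, map_add] at this
    refine lt_of_add_lt_add_right (a := ord.toSyn b) ?_
    rw [this]
    exact add_lt_add_right hlt _

lemma mem_spanPow_X_iff {s : Set σ} {t : ℕ} {g : MvPolynomial σ T} :
    g ∈ spanPow X s t ↔ ∀ m ∈ g.support, ∃ i ∈ s, t ≤ m i := by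
  have : spanPow (X : σ → MvPolynomial σ T) s t = Ideal.span
      ((fun m => monomial m (1 : T)) '' ((fun i => Finsupp.single i t) '' s)) := by
    rw [Set.image_image]
    simp only [spanPow, X_pow_eq_monomial]
  rw [this, mem_ideal_span_monomial_image]
  simp

lemma mem_spanPow_of_X_pow_mul_mem {s : Set σ} {i : σ} (hi : i ∉ s) (t : ℕ)
    (g : MvPolynomial σ T) (hg : X i ^ t * g ∈ spanPow X s t) : g ∈ spanPow X s t := by
  rw [mem_spanPow_X_iff] at hg ⊢
  intro m hm
  obtain ⟨j, hj, hjt⟩ := hg (Finsupp.single i t + m) (by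
    rwa [X_pow_eq_monomial, mem_support_iff, coeff_monomial_mul, one_mul, ← mem_support_iff])
  refine ⟨j, hj, ?_⟩
  have : i ≠ j := fun h => hi (h ▸ hj)
  simpa [Finsupp.single_apply, this] using hjt

variable [Fintype σ]

/-- The exponent all of whose coordinates are `N`. -/
noncomputable def constExponent (σ : Type*) [Finite σ] (N : ℕ) : σ →₀ ℕ :=
  Finsupp.equivFunOnFinite.symm fun _ => N

lemma prod_univ_X_pow_eq_monomial (N : ℕ) :
    (∏ i, X i : MvPolynomial σ T) ^ N = monomial (constExponent σ N) 1 := by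
  rw [← Finset.prod_pow, monomial_eq, C_1, one_mul, Finsupp.prod_fintype _ _ (fun _ => pow_zero _)]
  rfl

variable {H : Type*} [AddCommGroup H] [Module (MvPolynomial σ T) H]

/-- The maps `τ t` exhibit `H` as the colimit of `R ⧸ (x₁ᵗ, …, xₙᵗ, f)` with transition maps given
by multiplication by `x₁ ⋯ xₙ`, where `R` is the polynomial ring in the variables `xᵢ`. -/
structure IsInversePolynomialPresentation (f : MvPolynomial σ T)
    (τ : ℕ → MvPolynomial σ T →ₗ[MvPolynomial σ T] H) : Prop where
  exists_eq (h : H) : ∃ t g, τ t g = h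
  apply_mul (t : ℕ) (g) : τ (t + 1) ((∏ i, X i) * g) = τ t g
  apply_eq_zero_iff (t : ℕ) (g) :
    τ t g = 0 ↔ ∃ j, (∏ i, X i) ^ j * g ∈ spanPow X Set.univ (t + j) ⊔ Ideal.span {f}

namespace IsInversePolynomialPresentation

variable {f : MvPolynomial σ T} {τ : ℕ → MvPolynomial σ T →ₗ[MvPolynomial σ T] H}
  (h : IsInversePolynomialPresentation f τ)
include h

lemma apply_eq_zero {t : ℕ} {g : MvPolynomial σ T}
    (hg : g ∈ spanPow X Set.univ t ⊔ Ideal.span {f}) : τ t g = 0 :=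
  (h.apply_eq_zero_iff t g).2 ⟨0, by simpa using hg⟩

lemma apply_monomial_add (t j : ℕ) (u : σ →₀ ℕ) (c : T) :
    τ (t + j) (monomial (constExponent σ j + u) c) = τ t (monomial u c) := by
  have (j : ℕ) (g) : τ (t + j) ((∏ i, X i) ^ j * g) = τ t g := by
    induction j with
    | zero => simp
    | succ j ih => rw [pow_succ', mul_assoc, ← add_assoc, h.apply_mul, ih]
  rw [← this j, prod_univ_X_pow_eq_monomial, monomial_mul, one_mul]

lemma mem_of_apply_one_eq_zero {s : MvPolynomial σ T} (hs : τ 1 s = 0) :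
    s ∈ Ideal.span (Set.range X) ⊔
      (Ideal.span ((fun m => coeff m f) '' f.support)).map (C : T →+* MvPolynomial σ T) := by
  obtain ⟨j, hj⟩ := (h.apply_eq_zero_iff 1 s).1 hs
  obtain ⟨g, hg, _, hq, hgq⟩ := Submodule.mem_sup.1 hj
  obtain ⟨q, rfl⟩ := Ideal.mem_span_singleton'.1 hq
  classical
  have h0 : coeff 0 s = coeff (constExponent σ j) (q * f) := by
    have := congrArg (coeff (constExponent σ j)) hgq
    rw [prod_univ_X_pow_eq_monomial, coeff_monomial_mul', if_pos le_rfl, tsub_self, one_mul,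
      coeff_add,
      (notMem_support_iff (m := constExponent σ j)).1, zero_add] at this
    · exact this.symm
    · intro hm
      obtain ⟨i, -, hi⟩ := mem_spanPow_X_iff.1 hg _ hm
      exact absurd (show 1 + j ≤ j from hi) (by lia)
  have hC : coeff 0 s ∈ Ideal.span ((fun m => coeff m f) '' f.support) := by
    rw [h0, coeff_mul]
    refine Ideal.sum_mem _ fun m _ => Ideal.mul_mem_left _ _ ?_
    by_cases hm : m.2 ∈ f.support
    · exact Ideal.subset_span ⟨_, hm, rfl⟩
    · rw [notMem_support_iff.1 hm]
      exact Ideal.zero_mem _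
  rw [← sub_add_cancel s (C (coeff 0 s))]
  refine Submodule.add_mem_sup ?_ (Ideal.mem_map_of_mem _ hC)
  rw [← Set.image_univ, mem_ideal_span_X_image]
  intro m hm
  by_contra! h0
  have : m = 0 := by ext i; exact h0 i trivial
  rw [this] at hm
  simp at hm

lemma apply_monomial_eq_zero {t : ℕ} {u : σ →₀ ℕ} {i : σ} (hi : t ≤ u i) (c : T) :
    τ t (monomial u c) = 0 := by
  refine h.apply_eq_zero (Ideal.mem_sup_left (mem_spanPow_X_iff.2 fun m hm => ⟨i, trivial, ?_⟩))
  rwa [Finset.mem_singleton.1 (support_monomial_subset hm)]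

lemma apply_monomial_sub_eq {N N' : ℕ} {e : σ →₀ ℕ} (hN : e ≤ constExponent σ N)
    (hN' : e ≤ constExponent σ N') :
    τ (N + 1) (monomial (constExponent σ N - e) 1) =
      τ (N' + 1) (monomial (constExponent σ N' - e) 1) := by
  rw [← h.apply_monomial_add _ N', ← h.apply_monomial_add (N' + 1) N,
    ← add_tsub_assoc_of_le hN, ← add_tsub_assoc_of_le hN', add_comm (constExponent σ N')]
  congr 2
  lia

variable [Module T H] [IsScalarTower T (MvPolynomial σ T) H]

lemma contraction_eq_zero (e : σ →₀ ℕ) :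
    ∑ b ∈ f.support with b ≤ e, coeff b f •
      τ ((e - b).degree + 1) (monomial (constExponent σ (e - b).degree - (e - b)) 1) = 0 := by
  have hdeg (e : σ →₀ ℕ) : e ≤ constExponent σ e.degree := fun i => Finsupp.le_degree i e
  have h0 : τ (e.degree + 1) (monomial (constExponent σ e.degree - e) 1 * f) = 0 :=
    h.apply_eq_zero (Ideal.mem_sup_right (Ideal.mul_mem_left _ _ (Ideal.mem_span_singleton_self f)))
  conv at h0 =>
    enter [1, 2, 2]
    rw [f.as_sum]
  rw [Finset.mul_sum, map_sum] at h0
  rw [← h0, Finset.sum_filter]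
  refine Finset.sum_congr rfl fun b hb => ?_
  rw [monomial_mul, one_mul]
  split_ifs with hbe
  · rw [h.apply_monomial_sub_eq (hdeg _) (tsub_le_self.trans (hdeg e)),
      ← LinearMap.map_smul_of_tower,
      smul_monomial, smul_eq_mul, mul_one]
    congr 3
    exact tsub_tsub_assoc (hdeg e) hbe
  · obtain ⟨i, hi⟩ := not_forall.1 hbe
    refine (h.apply_monomial_eq_zero (i := i) ?_ _).symm
    have := hdeg e i
    simp only [Finsupp.add_apply, Finsupp.tsub_apply] at *
    change e.degree + 1 ≤ e.degree - e i + b i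
    change e i ≤ e.degree at this
    lia

lemma mem_primeSaturation_bot {n : ℕ} (hf : f.IsHomogeneous n) {p : Ideal T} [p.IsPrime]
    {a : σ →₀ ℕ} (ha : coeff a f ∉ p) (x : H) :
    x ∈ primeSaturation p (⊥ : Submodule T H) := by
  obtain ⟨t, g, rfl⟩ := h.exists_eq x
  rw [g.as_sum, map_sum]
  refine Submodule.sum_mem _ fun u _ => ?_
  by_cases hu : ∃ i, t ≤ u i
  · obtain ⟨i, hi⟩ := hu
    rw [h.apply_monomial_eq_zero hi]
    exact Submodule.zero_mem _
  · push Not at hu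
    rw [← mul_one (coeff u g), ← smul_eq_mul, ← smul_monomial, LinearMap.map_smul_of_tower]
    refine Submodule.smul_mem _ _ ?_
    have hut : constExponent σ 1 + u ≤ constExponent σ t := fun i => by
      change 1 + u i ≤ t
      have := hu i
      lia
    rw [← h.apply_monomial_add t 1, ← tsub_tsub_cancel_of_le hut,
      h.apply_monomial_sub_eq tsub_le_self fun i => Finsupp.le_degree i _]
    exact mem_primeSaturation_bot_of_contraction_eq_zero hf ha
      (fun e => τ (e.degree + 1) (monomial (constExponent σ e.degree - e) 1))
      h.contraction_eq_zero _

end IsInversePolynomialPresentation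

end

section

lemma IsTopLimit.isInversePolynomialPresentation {σ T H : Type*} [Fintype σ] [CommRing T]
    [AddCommGroup H] [Module (MvPolynomial σ T) H] {f : MvPolynomial σ T}
    {φ : ℕ → (MvPolynomial σ T ⧸ Ideal.span {f}) →ₗ[MvPolynomial σ T] H}
    (h : IsTopLimit (spanPow X Set.univ) (∏ i, X i) φ) :
    IsInversePolynomialPresentation f fun t => φ t ∘ₗ Submodule.mkQ (Ideal.span {f}) where
  exists_eq x := by
    obtain ⟨t, m, rfl⟩ := h.exists_eq x
    obtain ⟨g, rfl⟩ := Submodule.mkQ_surjective _ m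
    exact ⟨t, g, rfl⟩
  apply_mul t g := h.apply_smul t (Submodule.mkQ _ g)
  apply_eq_zero_iff t g := by
    refine (h.apply_eq_zero_iff t (Submodule.mkQ _ g)).trans (exists_congr fun j => ?_)
    rw [← map_smul, smul_eq_mul, ← Submodule.range_mkQ, ← Submodule.map_top, ← Submodule.map_smul'',
      ← Submodule.mem_comap, Submodule.comap_map_mkQ, Ideal.smul_top_eq_map, sup_comm]
    simp

variable {T : Type v} [CommRing T]

lemma exists_isInversePolynomialPresentation_localCohomology
    [IsNoetherianRing T] {σ : Type} [Fintype σ]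
    (f : MvPolynomial σ T) :
    ∃ τ : ℕ → MvPolynomial σ T →ₗ[MvPolynomial σ T]
      ((localCohomology (Ideal.span (Set.range (X : σ → MvPolynomial σ T)))
        (Fintype.card σ)).obj
          (ModuleCat.of (MvPolynomial σ T) (MvPolynomial σ T ⧸ Ideal.span {f}))),
      IsInversePolynomialPresentation f τ := by
  classical
  obtain ⟨κ, hκ⟩ := exists_isTopExtSystem_spanPow (X : σ → MvPolynomial σ T)
    (fun s i hi => mem_spanPow_of_X_pow_mul_mem hi) Finset.univ
  obtain ⟨φ, hφ⟩ := hκ.exists_isTopLimit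
    (ModuleCat.of (MvPolynomial σ T) (MvPolynomial σ T ⧸ Ideal.span {f}))
  obtain ⟨e⟩ := nonempty_localCohomology_iso_ofDiagram _
    (spanPow_succ_le (X : σ → MvPolynomial σ T) (Finset.univ : Finset σ))
    (Ideal.span (Set.range X))
    (fun t => Ideal.span_le.2 (by
      rintro _ ⟨i, rfl⟩
      exact ⟨t, Ideal.subset_span ⟨i, Finset.mem_coe.2 (Finset.mem_univ i), rfl⟩⟩))
    (fun k => ⟨k, Ideal.span_le.2 (by
      rintro _ ⟨i, -, rfl⟩
      exact Ideal.pow_mem_pow (Ideal.subset_span (Set.mem_range_self i)) k)⟩)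
    (Finset.univ : Finset σ).card
  let E := (e.app (ModuleCat.of _ (MvPolynomial σ T ⧸ Ideal.span {f}))).toLinearEquiv
  have hφ' : IsTopLimit (spanPow X Set.univ) (∏ i, X i) fun t => E.toLinearMap ∘ₗ φ t :=
    ⟨fun h => by
      obtain ⟨t, m, hm⟩ := hφ.exists_eq (E.symm h)
      exact ⟨t, m, (congrArg E hm).trans (E.apply_symm_apply h)⟩,
    fun t m => congrArg E (hφ.apply_smul t m),
    fun t m => by
      rw [← Finset.coe_univ]
      exact E.map_eq_zero_iff.trans (hφ.apply_eq_zero_iff t m)⟩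
  exact ⟨_, hφ'.isInversePolynomialPresentation⟩

lemma IsInversePolynomialPresentation.support_eq {σ H : Type*} [Fintype σ] [AddCommGroup H]
    [Module (MvPolynomial σ T) H] {f : MvPolynomial σ T}
    {τ : ℕ → MvPolynomial σ T →ₗ[MvPolynomial σ T] H}
    (h : IsInversePolynomialPresentation f τ) {n : ℕ} (hf : f.IsHomogeneous n) :
    Module.support (MvPolynomial σ T) H = {Q | Ideal.span (Set.range X) ⊔
      (Ideal.span ((fun m => coeff m f) '' f.support)).map (C : T →+* MvPolynomial σ T) ≤
        Q.asIdeal} := by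
  ext Q
  rw [Module.mem_support_iff_exists_annihilator, Set.mem_ofPred_eq]
  constructor
  · rintro ⟨x, hx⟩
    refine sup_le (Ideal.span_le.2 ?_) (Ideal.map_le_iff_le_comap.2 (Ideal.span_le.2 ?_))
    · rintro _ ⟨i, rfl⟩
      obtain ⟨t, g, rfl⟩ := h.exists_eq x
      refine Q.2.mem_of_pow_mem t (hx ((Submodule.mem_annihilator_span_singleton _ _).2 ?_))
      rw [← map_smul, smul_eq_mul]
      exact h.apply_eq_zero (Ideal.mem_sup_left (Ideal.mul_mem_right _ _
        (Ideal.subset_span ⟨i, trivial, rfl⟩)))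
    · rintro _ ⟨a, -, rfl⟩
      by_contra ha
      let _ : Module T H := Module.compHom H (C : T →+* MvPolynomial σ T)
      have : IsScalarTower T (MvPolynomial σ T) H := ⟨fun r s y => by
        rw [smul_eq_C_mul, mul_smul]
        rfl⟩
      obtain ⟨s, hs, hsx⟩ := h.mem_primeSaturation_bot hf (p := Q.asIdeal.comap C) ha x
      exact hs (hx ((Submodule.mem_annihilator_span_singleton _ _).2 hsx))
  · refine fun hQ => ⟨τ 1 1, fun s hs => hQ (h.mem_of_apply_one_eq_zero ?_)⟩
    have := (Submodule.mem_annihilator_span_singleton _ _).1 hs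
    rwa [← map_smul, smul_eq_mul, mul_one] at this

end

/-- **Marley–Vassilev, Lemma 2.4.**
Let `(T, m)` be a Noetherian local ring, `R = T[x₁,…,xₙ]`, `I = (x₁,…,xₙ)R`, and let
`f ∈ R` be homogeneous with `C_f ⊆ T` the ideal generated by its (nonzero) coefficients.
Then `Supp_R Hⁿ_I(R/fR) = { Q ∈ Spec R ∣ Q ⊇ I + C_f R }`. -/
theorem support_top_localCohomology
    {T : Type} [CommRing T] [IsLocalRing T] [IsNoetherianRing T]
    (n : ℕ) (f : MvPolynomial (Fin n) T) (p : ℕ) (hf : f.IsHomogeneous p) :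
    letI R := MvPolynomial (Fin n) T
    letI I : Ideal R := Ideal.span (Set.range (X : Fin n → R))
    letI Cf : Ideal T := Ideal.span ((fun m => MvPolynomial.coeff m f) '' ↑f.support)
    Module.support R ((localCohomology I n).obj
        (ModuleCat.of (MvPolynomial (Fin n) T) (MvPolynomial (Fin n) T ⧸ Ideal.span {f})))
      = { Q : PrimeSpectrum (MvPolynomial (Fin n) T) |
            I ⊔ Cf.map (C : T →+* MvPolynomial (Fin n) T) ≤ Q.asIdeal } := by
  have := exists_isInversePolynomialPresentation_localCohomology f
  rw [Fintype.card_fin] at this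
  obtain ⟨τ, hτ⟩ := this
  exact hτ.support_eq hf
end

section
/- Let (T,m) be a Noetherian local ring, R = T[x_1,…,x_n] a polynomial ring over T, and I = (x_1,…,x_n)R. Let f ∈ R be a homogeneous element and let C_f ⊆ T be the ideal generated by the coefficients of f. Then H^n_I(R/fR) = 0 if and only if C_f = T, i.e., if and only if some coefficient of f is a unit of T. -/
universe w v u t

section Ext

open CategoryTheory Opposite HomologicalComplex ProjectiveResolution

variable {R : Type t} [CommRing R] {C : Type u} [Category.{v} C] [Abelian C] [Linear R C]

lemma comp_comp_inv_eq_of_squares {D : Type*} [Category* D] {A A' H H' K K' : D}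
    {m : A ⟶ A'} {e : A ⟶ H} {e' : A' ⟶ H'} {μ : H ⟶ H'} {ν : K ⟶ K'}
    (h₁ : m ≫ e' = e ≫ μ) (k : K ≅ H) (k' : K' ≅ H') (h₂ : k.hom ≫ μ = ν ≫ k'.hom) :
    m ≫ e' ≫ k'.inv = (e ≫ k.inv) ≫ ν := by
  rw [reassoc_of% h₁, Category.assoc]
  congr 1
  rw [Iso.eq_inv_comp, ← Category.assoc, h₂]
  simp

/-- The cochain map induced on `Hom(-, Y)` by a chain map. -/
noncomputable def ChainComplex.linearYonedaMap (R : Type t) [CommRing R] [Linear R C]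
    {K L : ChainComplex C ℕ} (φ : K ⟶ L) (Y : C) :
    L.linearYonedaObj R Y ⟶ K.linearYonedaObj R Y :=
  (unopFunctor _ _).map ((((linearYoneda R C).obj Y).rightOp.mapHomologicalComplex _).map φ).op

lemma CategoryTheory.ProjectiveResolution.isoExt_hom_naturality_s2 [EnoughProjectives C]
    {X' X : C} {g : X' ⟶ X} {P' : ProjectiveResolution X'} {P : ProjectiveResolution X}
    (φ : ProjectiveResolution.Hom P' P g) (n : ℕ) (Y : C) :
    ((Ext R C n).map g.op).app Y ≫ (P'.isoExt n Y).hom =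
      (P.isoExt n Y).hom ≫ homologyMap (ChainComplex.linearYonedaMap R φ.hom Y) n := by
  have h1 := congrArg Quiver.Hom.unop (ProjectiveResolution.isoLeftDerivedObj_inv_naturality g P' P
    φ.hom (by simpa using φ.hom_f_zero_comp_π_f_zero) ((linearYoneda R C).obj Y).rightOp n)
  have h2 := congrArg Quiver.Hom.unop
    (homologyOp_hom_naturality (ChainComplex.linearYonedaMap R φ.hom Y) n)
  exact comp_comp_inv_eq_of_squares h1 (HomologicalComplex.homologyUnop _ _)
    (HomologicalComplex.homologyUnop _ _) h2

section

variable {A : Type t} [Ring A] (K : CochainComplex (ModuleCat.{v} A) ℕ) (n : ℕ)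

lemma CochainComplex.exists_iCycles_eq (x : K.X n) (hx : (K.d n (n + 1)).hom x = 0) :
    ∃ z : K.cycles n, (K.iCycles n).hom z = x :=
  (ShortComplex.moduleCat_exact_iff _).1
    (ShortComplex.exact_of_f_is_kernel (ShortComplex.mk _ _ (K.iCycles_d n (n + 1)))
      (K.cyclesIsKernel n (n + 1) (by simp))) x hx

lemma CochainComplex.iCycles_injective : Function.Injective (K.iCycles n).hom :=
  (ModuleCat.mono_iff_injective _).1 inferInstance

lemma CochainComplex.homologyπ_eq_zero_iff (z : K.cycles n) :
    (K.homologyπ n).hom z = 0 ↔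
      ∃ y, (K.d ((ComplexShape.up ℕ).prev n) n).hom y = (K.iCycles n).hom z := by
  have h := (ShortComplex.moduleCat_exact_iff _).1
    (ShortComplex.exact_of_g_is_cokernel (ShortComplex.mk _ _ (K.toCycles_comp_homologyπ _ n))
      (K.homologyIsCokernel _ n rfl))
  constructor
  · intro hz
    obtain ⟨y, rfl⟩ := h z hz
    exact ⟨y, (ConcreteCategory.congr_hom (K.toCycles_i _ n) y).symm⟩
  · rintro ⟨y, hy⟩
    obtain rfl : (K.toCycles _ n).hom y = z := by
      apply CochainComplex.iCycles_injective
      rw [← hy]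
      exact ConcreteCategory.congr_hom (K.toCycles_i _ n) y
    exact ConcreteCategory.congr_hom (K.toCycles_comp_homologyπ _ n) y

lemma CochainComplex.apply_inv_homologyπ_eq_zero_iff {K L : CochainComplex (ModuleCat.{v} A) ℕ}
    (ψ : K ⟶ L) (n : ℕ) {E F : ModuleCat.{v} A} (e : E ≅ K.homology n) (e' : F ≅ L.homology n)
    (μ : E ⟶ F) (h : μ ≫ e'.hom = e.hom ≫ homologyMap ψ n) (z : K.cycles n) :
    μ.hom (e.inv.hom ((K.homologyπ n).hom z)) = 0 ↔
      ∃ y, (L.d ((ComplexShape.up ℕ).prev n) n).hom y = (ψ.f n).hom ((K.iCycles n).hom z) := by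
  have h1 := ConcreteCategory.congr_hom (cyclesMap_i ψ n) z
  have h2 : e'.toLinearEquiv (μ.hom (e.inv.hom ((K.homologyπ n).hom z))) =
      (L.homologyπ n).hom ((cyclesMap ψ n).hom z) := by
    have h3 : (K.homologyπ n ≫ e.inv) ≫ μ ≫ e'.hom = cyclesMap ψ n ≫ L.homologyπ n := by
      rw [h, Category.assoc, e.inv_hom_id_assoc, homologyπ_naturality]
    exact ConcreteCategory.congr_hom h3 z
  rw [← e'.toLinearEquiv.map_eq_zero_iff, h2, CochainComplex.homologyπ_eq_zero_iff]
  exact exists_congr fun y ↦ Iff.of_eq (congrArg _ h1)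

end

variable [HasExt.{w} C]

lemma CategoryTheory.ProjectiveResolution.extMk_eq_zero_iff_prev {X Y : C}
    (P : ProjectiveResolution X) {n : ℕ} (f : P.complex.X n ⟶ Y)
    (hf : P.complex.d (n + 1) n ≫ f = 0) :
    P.extMk f (n + 1) rfl hf = 0 ↔
      ∃ g : P.complex.X ((ComplexShape.up ℕ).prev n) ⟶ Y,
        P.complex.d n ((ComplexShape.up ℕ).prev n) ≫ g = f := by
  cases n with
  | succ n =>
    rw [P.extMk_eq_zero_iff f _ rfl hf n rfl, CochainComplex.prev_nat_succ]
  | zero =>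
    refine ⟨fun h ↦ ⟨0, ?_⟩, fun ⟨g, hg⟩ ↦ ?_⟩
    · rw [← P.extEquivCohomologyClass.apply_eq_iff_eq, extEquivCohomologyClass_extMk,
        extEquivCohomologyClass_zero, CochainComplex.HomComplex.CohomologyClass.mk_eq_zero_iff,
        CochainComplex.HomComplex.Cocycle.toSingleMk_mem_coboundaries_iff _ _ _ _ _ 1
          (by simp)] at h
      obtain ⟨g, hg⟩ := h
      rw [(P.cochainComplex.isZero_of_isStrictlyLE 0 1).eq_of_src g 0, Limits.comp_zero] at hg
      rw [Limits.comp_zero, ← cancel_epi (P.cochainComplexXIso (-(0 : ℕ)) 0 rfl).hom,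
        Limits.comp_zero, hg]
    · obtain rfl : f = 0 := by
        rw [← hg, P.complex.shape _ _ (by simp), Limits.zero_comp]
      exact P.extMk_zero _ _

variable [EnoughProjectives C]


/-- Restriction along `g : X' ⟶ X` kills a class of the derived functor `Ext` if and only if it
kills the class in `Abelian.Ext` of the same cocycle. -/
lemma ext_map_eq_zero_iff {X' X Y : C} {n : ℕ} (P : ProjectiveResolution X)
    (z : (P.complex.linearYonedaObj R Y).cycles n) (f : P.complex.X n ⟶ Y)
    (hz : ((P.complex.linearYonedaObj R Y).iCycles n).hom z = f)
    (hf : P.complex.d (n + 1) n ≫ f = 0) (g : X' ⟶ X) :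
    (((Ext R C n).map g.op).app Y).hom
      ((P.isoExt n Y).inv.hom (((P.complex.linearYonedaObj R Y).homologyπ n).hom z)) = 0 ↔
    (Abelian.Ext.mk₀ g).comp (P.extMk f (n + 1) rfl hf) (zero_add n) = 0 := by
  let P' := projectiveResolution X'
  let φ : ProjectiveResolution.Hom P' P g :=
    ⟨ProjectiveResolution.lift g P' P, by
      simpa using ProjectiveResolution.lift_commutes_zero g P' P⟩
  rw [mk₀_comp_extMk (φ := φ), extMk_eq_zero_iff_prev]
  refine (CochainComplex.apply_inv_homologyπ_eq_zero_iff _ n _ _ _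
    (isoExt_hom_naturality_s2 (R := R) φ n Y) z).trans ?_
  subst hz
  rfl

lemma exists_abelianExt_of_ext {X Y : C} {n : ℕ} (α : ((Ext R C n).obj (op X)).obj Y) :
    ∃ x : Abelian.Ext.{w} X Y n, ∀ (X' : C) (g : X' ⟶ X),
      (((Ext R C n).map g.op).app Y).hom α = 0 ↔
        (Abelian.Ext.mk₀ g).comp x (zero_add n) = 0 := by
  let P := projectiveResolution X
  obtain ⟨z, hz⟩ := (ModuleCat.epi_iff_surjective
    ((P.complex.linearYonedaObj R Y).homologyπ n)).1 inferInstance ((P.isoExt n Y).hom.hom α)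
  have hα : (P.isoExt n Y).inv.hom (((P.complex.linearYonedaObj R Y).homologyπ n).hom z) = α :=
    (congrArg (P.isoExt n Y).inv.hom hz).trans
      (ConcreteCategory.congr_hom (P.isoExt n Y).hom_inv_id α)
  refine ⟨P.extMk (((P.complex.linearYonedaObj R Y).iCycles n).hom z) (n + 1) rfl
    (ConcreteCategory.congr_hom ((P.complex.linearYonedaObj R Y).iCycles_d n (n + 1)) z),
    fun X' g ↦ ?_⟩
  refine (Iff.of_eq ?_).trans (ext_map_eq_zero_iff P z _ rfl _ g)
  exact congrArg (fun α ↦ (((Ext R C n).map g.op).app Y).hom α = 0) hα.symm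

lemma exists_ext_of_abelianExt (R : Type t) [CommRing R] [Linear R C] {X Y : C} {n : ℕ}
    (x : Abelian.Ext.{w} X Y n) :
    ∃ α : ((Ext R C n).obj (op X)).obj Y, ∀ (X' : C) (g : X' ⟶ X),
      (((Ext R C n).map g.op).app Y).hom α = 0 ↔
        (Abelian.Ext.mk₀ g).comp x (zero_add n) = 0 := by
  let P := projectiveResolution X
  obtain ⟨f, hf, rfl⟩ := P.extMk_surjective x (n + 1) rfl
  obtain ⟨z, hz⟩ := CochainComplex.exists_iCycles_eq (P.complex.linearYonedaObj R Y) n f hf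
  exact ⟨_, fun X' g ↦ ext_map_eq_zero_iff P z f hz hf g⟩

end Ext

section LocalCohomology

open CategoryTheory Opposite Limits

lemma ModuleCat.subsingleton_pt_iff_of_isColimit {A : Type u} [Ring A] {J : Type} [SmallCategory J]
    [IsFiltered J] {F : J ⥤ ModuleCat.{u} A} {c : Cocone F} (hc : IsColimit c) :
    Subsingleton c.pt ↔ ∀ (j : J) (x : F.obj j), ∃ (k : J) (f : j ⟶ k), (F.map f).hom x = 0 := by
  have : PreservesFilteredColimitsOfSize.{0, 0} (forget (ModuleCat.{u} A)) :=
    preservesSmallestFilteredColimits_of_preservesFilteredColimits.{u, u} _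
  refine ⟨fun h j x ↦ ?_, fun h ↦ ⟨fun a b ↦ ?_⟩⟩
  · obtain ⟨k, f, g, hfg⟩ := (Concrete.isColimit_rep_eq_iff_exists F hc x (0 : F.obj j)).1
      (Subsingleton.elim (α := c.pt) _ _)
    exact ⟨k, f, hfg.trans (map_zero (F.map g).hom)⟩
  · have h0 (a : c.pt) : a = 0 := by
      obtain ⟨j, x, rfl⟩ := Concrete.isColimit_exists_rep F hc a
      obtain ⟨k, f, hf⟩ := h j x
      refine ((ConcreteCategory.congr_hom (c.w f) x).symm.trans ?_)
      exact (congrArg (c.ι.app k).hom hf).trans (map_zero _)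
    rw [h0 a, h0 b]

open localCohomology in
lemma localCohomology.subsingleton_obj_iff {R : Type u} [CommRing R] (J : Ideal R) (n : ℕ)
    (M : ModuleCat.{u} R) :
    Subsingleton ((localCohomology J n).obj M) ↔
      ∀ (t : ℕ) (x : Abelian.Ext.{u} (ModuleCat.of R (R ⧸ J ^ t)) M n), ∃ s, ∃ h : t ≤ s,
        (Abelian.Ext.mk₀ (ModuleCat.ofHom
          (Submodule.factor (Ideal.pow_le_pow_right (I := J) h)))).comp x (zero_add n) = 0 := by
  have hc := isColimitOfPreserves ((evaluation _ _).obj M)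
    (colimit.isColimit (diagram (idealPowersDiagram J) n))
  refine (ModuleCat.subsingleton_pt_iff_of_isColimit hc).trans ⟨fun h t x ↦ ?_, fun h j α ↦ ?_⟩
  · obtain ⟨α, hα⟩ := exists_ext_of_abelianExt R x
    obtain ⟨k, f, hf⟩ := h (op (op t)) α
    exact ⟨k.unop.unop, f.unop.unop.down.down, (hα _ _).1 hf⟩
  · obtain ⟨x, hx⟩ := exists_abelianExt_of_ext.{u} α
    obtain ⟨s, hs, h0⟩ := h j.unop.unop x
    exact ⟨op (op s), (homOfLE hs).op.op, (hx _ _).2 h0⟩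

end LocalCohomology

section RegularSequence

open CategoryTheory Abelian

variable {R : Type u} [CommRing R]

/-- The vanishing in the colimit over `t` of all elements of `Ext n (R ⧸ J t) M`. -/
def ExtColimitVanishes {J : ℕ → Ideal R} (hJ : Antitone J) (n : ℕ) (M : ModuleCat.{u} R) : Prop :=
  ∀ (t : ℕ) (x : Ext.{u} (ModuleCat.of R (R ⧸ J t)) M n), ∃ s, ∃ h : t ≤ s,
    (Ext.mk₀ (ModuleCat.ofHom (Submodule.factor (hJ h)))).comp x (zero_add n) = 0

lemma Submodule.mk₀_factor_comp_mk₀_factor_comp {I J K : Ideal R} (h : I ≤ J) (h' : J ≤ K) {n : ℕ}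
    {M : ModuleCat.{u} R} (x : Ext.{u} (ModuleCat.of R (R ⧸ K)) M n) :
    (Ext.mk₀ (ModuleCat.ofHom (Submodule.factor h))).comp
      ((Ext.mk₀ (ModuleCat.ofHom (Submodule.factor h'))).comp x (zero_add n)) (zero_add n) =
      (Ext.mk₀ (ModuleCat.ofHom (Submodule.factor (h.trans h')))).comp x (zero_add n) := by
  rw [Ext.mk₀_comp_mk₀_assoc, ← ModuleCat.ofHom_comp, Submodule.factor_comp]

lemma ExtColimitVanishes.of_cofinal {J K : ℕ → Ideal R} {hJ : Antitone J} (hK : Antitone K)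
    (hJK : ∀ t, ∃ s, J s ≤ K t) (hKJ : ∀ t, ∃ s, K s ≤ J t) {n : ℕ} {M : ModuleCat.{u} R}
    (h : ExtColimitVanishes hJ n M) : ExtColimitVanishes hK n M := by
  intro t x
  obtain ⟨a, ha⟩ := hJK t
  obtain ⟨b, hab, hb⟩ := h a ((Ext.mk₀ (ModuleCat.ofHom (Submodule.factor ha))).comp x (zero_add n))
  obtain ⟨s, hs⟩ := hKJ b
  refine ⟨max s t, le_max_right _ _, ?_⟩
  have h0 := congrArg (fun y ↦ (Ext.mk₀ (ModuleCat.ofHom (Submodule.factor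
    ((hK (le_max_left s t)).trans hs)))).comp y (zero_add n)) hb
  simpa only [Submodule.mk₀_factor_comp_mk₀_factor_comp, Ext.comp_zero] using h0

lemma extColimitVanishes_iff_of_cofinal {J K : ℕ → Ideal R} (hJ : Antitone J) (hK : Antitone K)
    (hJK : ∀ t, ∃ s, J s ≤ K t) (hKJ : ∀ t, ∃ s, K s ≤ J t) (n : ℕ) (M : ModuleCat.{u} R) :
    ExtColimitVanishes hJ n M ↔ ExtColimitVanishes hK n M :=
  ⟨.of_cofinal hK hJK hKJ, .of_cofinal hJ hKJ hJK⟩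

/-- A compatible system `ε` of classes in `Ext j (R ⧸ J t) R` which generate all
`Ext j (R ⧸ J t) M ≃ M / J t M`, the transition maps being multiplication by powers of `c`. -/
structure IsExtGeneratingSystem (J : ℕ → Ideal R) (c : R) (j : ℕ)
    (ε : ∀ t, Ext.{u} (ModuleCat.of R (R ⧸ J t)) (ModuleCat.of R R) j) : Prop where
  exists_eq (t : ℕ) (M : ModuleCat.{u} R) (x : Ext.{u} (ModuleCat.of R (R ⧸ J t)) M j) :
    ∃ m : M, (ε t).comp (Ext.mk₀ (ModuleCat.ofHom (LinearMap.toSpanSingleton R M m)))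
      (add_zero j) = x
  mem_of_eq_zero (t : ℕ) (M : ModuleCat.{u} R) (m : M) :
    (ε t).comp (Ext.mk₀ (ModuleCat.ofHom (LinearMap.toSpanSingleton R M m))) (add_zero j) = 0 →
      m ∈ J t • (⊤ : Submodule R M)
  factor_comp (t s : ℕ) (h : t ≤ s) (hJ : J s ≤ J t) :
    (Ext.mk₀ (ModuleCat.ofHom (Submodule.factor hJ))).comp (ε t) (zero_add j) = c ^ (s - t) • ε s
  subsingleton (t : ℕ) (M : ModuleCat.{u} R) (i : ℕ) (hi : j < i) :
    Subsingleton (Ext.{u} (ModuleCat.of R (R ⧸ J t)) M i)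

lemma mk₀_ofHom_toSpanSingleton_smul {M : ModuleCat.{u} R} (r : R) (m : M) :
    Ext.mk₀ (ModuleCat.ofHom (LinearMap.toSpanSingleton R M (r • m))) =
      r • Ext.mk₀ (ModuleCat.ofHom (LinearMap.toSpanSingleton R M m)) := by
  rw [← Ext.mk₀_smul]
  congr 1
  ext
  simp

lemma mk₀_ofHom_toSpanSingleton_add {M : ModuleCat.{u} R} (m m' : M) :
    Ext.mk₀ (ModuleCat.ofHom (LinearMap.toSpanSingleton R M (m + m'))) =
      Ext.mk₀ (ModuleCat.ofHom (LinearMap.toSpanSingleton R M m)) +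
        Ext.mk₀ (ModuleCat.ofHom (LinearMap.toSpanSingleton R M m')) := by
  rw [← Ext.mk₀_add]
  congr 1
  ext
  simp

lemma mk₀_ofHom_toSpanSingleton_sub {M : ModuleCat.{u} R} (m m' : M) :
    Ext.mk₀ (ModuleCat.ofHom (LinearMap.toSpanSingleton R M (m - m'))) =
      Ext.mk₀ (ModuleCat.ofHom (LinearMap.toSpanSingleton R M m)) -
        Ext.mk₀ (ModuleCat.ofHom (LinearMap.toSpanSingleton R M m')) := by
  rw [eq_sub_iff_add_eq, ← mk₀_ofHom_toSpanSingleton_add, sub_add_cancel]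

lemma smul_ext_quotient_eq_zero {I : Ideal R} {M : ModuleCat.{u} R} {n : ℕ}
    (x : Ext.{u} (ModuleCat.of R (R ⧸ I)) M n) {r : R} (hr : r ∈ I) : r • x = 0 := by
  have h0 : r • 𝟙 (ModuleCat.of R (R ⧸ I)) = 0 := by
    ext
    simpa [← Ideal.Quotient.mk_eq_mk, ← Submodule.Quotient.mk_smul] using
      (Submodule.Quotient.mk_eq_zero I).2 hr
  rw [← x.mk₀_id_comp, ← Ext.smul_comp, ← Ext.mk₀_smul, h0, Ext.mk₀_zero, Ext.zero_comp]

lemma comp_mk₀_ofHom_toSpanSingleton_eq_zero {I : Ideal R} {M : ModuleCat.{u} R} {n : ℕ}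
    (x : Ext.{u} (ModuleCat.of R (R ⧸ I)) (ModuleCat.of R R) n) {m : M}
    (hm : m ∈ I • (⊤ : Submodule R M)) :
    x.comp (Ext.mk₀ (ModuleCat.ofHom (LinearMap.toSpanSingleton R M m))) (add_zero n) = 0 := by
  induction hm using Submodule.smul_induction_on' with
  | smul r hr m hm =>
    rw [mk₀_ofHom_toSpanSingleton_smul, Ext.comp_smul, smul_ext_quotient_eq_zero _ hr]
  | add m hm m' hm' h h' => rw [mk₀_ofHom_toSpanSingleton_add, Ext.comp_add, h, h', add_zero]

lemma IsExtGeneratingSystem.extColimitVanishes_iff {J : ℕ → Ideal R} (hJ : Antitone J) {c : R}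
    {j : ℕ} {ε : ∀ t, Ext.{u} (ModuleCat.of R (R ⧸ J t)) (ModuleCat.of R R) j}
    (h : IsExtGeneratingSystem J c j ε) (M : ModuleCat.{u} R) :
    ExtColimitVanishes hJ j M ↔
      ∀ (t : ℕ) (m : M), ∃ s ≥ t, c ^ (s - t) • m ∈ J s • (⊤ : Submodule R M) := by
  have key (t s : ℕ) (hts : t ≤ s) (m : M) :
      (Ext.mk₀ (ModuleCat.ofHom (Submodule.factor (hJ hts)))).comp
        ((ε t).comp (Ext.mk₀ (ModuleCat.ofHom (LinearMap.toSpanSingleton R M m)))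
          (add_zero j)) (zero_add j) =
      (ε s).comp (Ext.mk₀ (ModuleCat.ofHom (LinearMap.toSpanSingleton R M (c ^ (s - t) • m))))
        (add_zero j) := by
    rw [← Ext.comp_assoc_of_third_deg_zero, h.factor_comp t s hts, Ext.smul_comp,
      mk₀_ofHom_toSpanSingleton_smul, Ext.comp_smul]
  constructor
  · intro H t m
    obtain ⟨s, hts, hs⟩ := H t ((ε t).comp
      (Ext.mk₀ (ModuleCat.ofHom (LinearMap.toSpanSingleton R M m))) (add_zero j))
    exact ⟨s, hts, h.mem_of_eq_zero s M _ ((key t s hts m).symm.trans hs)⟩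
  · intro H t x
    obtain ⟨m, rfl⟩ := h.exists_eq t M x
    obtain ⟨s, hts, hs⟩ := H t m
    exact ⟨s, hts, (key t s hts m).trans (comp_mk₀_ofHom_toSpanSingleton_eq_zero _ hs)⟩

lemma exists_isExtGeneratingSystem_of_eq_bot {J : ℕ → Ideal R} (hJ : ∀ t, J t = ⊥) :
    ∃ ε, IsExtGeneratingSystem J 1 0 ε := by
  let e (t : ℕ) := Submodule.quotEquivOfEqBot (J t) (hJ t)
  have hP (t : ℕ) : Projective (ModuleCat.of R (R ⧸ J t)) :=
    Projective.of_iso (e t).symm.toModuleIso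
      (ModuleCat.projective_of_free (Module.Basis.singleton Unit R))
  refine ⟨fun t ↦ Ext.mk₀ (ModuleCat.ofHom (e t).toLinearMap), ⟨?_, ?_, ?_, ?_⟩⟩
  · intro t M x
    obtain ⟨f, rfl⟩ := (Ext.mk₀_bijective _ _).2 x
    refine ⟨f.hom (Submodule.Quotient.mk 1), ?_⟩
    rw [Ext.mk₀_comp_mk₀]
    congr 1
    ext
    exact one_smul R _
  · intro t M m h
    rw [Ext.mk₀_comp_mk₀, Ext.mk₀_eq_zero_iff] at h
    have hm : (1 : R) • m = 0 := ConcreteCategory.congr_hom h (Submodule.Quotient.mk (1 : R))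
    rw [← one_smul R m, hm]
    exact zero_mem _
  · intro t s h hJ
    rw [Ext.mk₀_comp_mk₀, one_pow, one_smul]
    congr 1
    ext
    rfl
  · intro t M i hi
    obtain ⟨i, rfl⟩ := Nat.exists_eq_succ_of_ne_zero hi.ne'
    exact Ext.subsingleton_of_projective _ _ _

/-- The complex `0 → R ⧸ J → R ⧸ J → R ⧸ (J + (y)) → 0` whose first map is multiplication by `y`. -/
noncomputable abbrev quotientMulShortComplex (J : Ideal R) (y : R) :
    ShortComplex (ModuleCat.{u} R) :=
  ShortComplex.mk (ModuleCat.ofHom (y • LinearMap.id : R ⧸ J →ₗ[R] R ⧸ J))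
    (ModuleCat.ofHom (Submodule.factor (le_sup_left : J ≤ J ⊔ Ideal.span {y}))) (by
      ext
      change Submodule.Quotient.mk (y • (1 : R)) = _
      refine (Submodule.Quotient.mk_eq_zero _).2 ?_
      simpa using Ideal.mem_sup_right (Ideal.mem_span_singleton_self y))

lemma quotientMulShortComplex_shortExact {J : Ideal R} {y : R} (h : ∀ r, y * r ∈ J → r ∈ J) :
    (quotientMulShortComplex J y).ShortExact := by
  apply ModuleCat.shortComplex_shortExact
  · intro a
    obtain ⟨a, rfl⟩ := Submodule.Quotient.mk_surjective _ a
    refine ⟨fun ha ↦ ?_, ?_⟩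
    · obtain ⟨b, hb, z, hz, rfl⟩ := Submodule.mem_sup.1 ((Submodule.Quotient.mk_eq_zero _).1 ha)
      obtain ⟨r, rfl⟩ := Ideal.mem_span_singleton'.1 hz
      refine ⟨Submodule.Quotient.mk r, (Submodule.Quotient.eq _).2 ?_⟩
      simpa [mul_comm y r] using neg_mem hb
    · rintro ⟨b, hb⟩
      rw [← hb]
      exact ConcreteCategory.congr_hom (quotientMulShortComplex J y).zero b
  · refine (injective_iff_map_eq_zero (quotientMulShortComplex J y).f.hom).2 fun a ha ↦ ?_
    obtain ⟨a, rfl⟩ := Submodule.Quotient.mk_surjective _ a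
    exact (Submodule.Quotient.mk_eq_zero _).2 (h a ((Submodule.Quotient.mk_eq_zero _).1 ha))
  · exact Submodule.factor_surjective le_sup_left

/-- The morphism between the complexes `quotientMulShortComplex` for `y ^ s` and `y ^ t`. -/
noncomputable abbrev quotientMulShortComplexMap {J J' : Ideal R} (y : R) {t s : ℕ} (hts : t ≤ s)
    (hJ : J' ≤ J) (hK : J' ⊔ Ideal.span {y ^ s} ≤ J ⊔ Ideal.span {y ^ t}) :
    quotientMulShortComplex J' (y ^ s) ⟶ quotientMulShortComplex J (y ^ t) where
  τ₁ := y ^ (s - t) • ModuleCat.ofHom (Submodule.factor hJ)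
  τ₂ := ModuleCat.ofHom (Submodule.factor hJ)
  τ₃ := ModuleCat.ofHom (Submodule.factor hK)
  comm₁₂ := by
    ext
    change Submodule.Quotient.mk (y ^ t • y ^ (s - t) • (1 : R)) =
      Submodule.Quotient.mk (y ^ s • (1 : R))
    rw [smul_smul, ← pow_add, Nat.add_sub_cancel' hts]
  comm₂₃ := by
    ext
    rfl

lemma IsExtGeneratingSystem.exists_sup_span_pow {J : ℕ → Ideal R} (hJ : Antitone J) {c : R} {j : ℕ}
    {ε : ∀ t, Ext.{u} (ModuleCat.of R (R ⧸ J t)) (ModuleCat.of R R) j}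
    (h : IsExtGeneratingSystem J c j ε) (y : R) (hy : ∀ t r, y ^ t * r ∈ J t → r ∈ J t) :
    ∃ ε', IsExtGeneratingSystem (fun t ↦ J t ⊔ Ideal.span {y ^ t}) (c * y) (j + 1) ε' := by
  have hS (t : ℕ) := quotientMulShortComplex_shortExact (hy t)
  have smul_f (t : ℕ) {M : ModuleCat.{u} R} {i : ℕ} (x : Ext.{u} (ModuleCat.of R (R ⧸ J t)) M i) :
      (Ext.mk₀ (quotientMulShortComplex (J t) (y ^ t)).f).comp x (zero_add i) = y ^ t • x :=
    calc _ = (Ext.mk₀ (y ^ t • 𝟙 (ModuleCat.of R (R ⧸ J t)))).comp x (zero_add i) := rfl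
      _ = _ := by rw [Ext.mk₀_smul, Ext.smul_comp, Ext.mk₀_id_comp]
  refine ⟨fun t ↦ (hS t).extClass.comp (ε t) (add_comm 1 j), ⟨?_, ?_, ?_, ?_⟩⟩
  · intro t M x
    have := h.subsingleton t M (j + 1) (Nat.lt_succ_self j)
    obtain ⟨x₁, rfl⟩ := Ext.contravariant_sequence_exact₃ (hS t) M x (Subsingleton.elim _ _)
      (add_comm 1 j)
    obtain ⟨m, rfl⟩ := h.exists_eq t M x₁
    exact ⟨m, Ext.comp_assoc_of_third_deg_zero ..⟩
  · intro t M m hm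
    rw [Ext.comp_assoc_of_third_deg_zero] at hm
    obtain ⟨x₂, hx₂⟩ := Ext.contravariant_sequence_exact₁ (hS t) M _ _ hm
    obtain ⟨m', rfl⟩ := h.exists_eq t M x₂
    have hx : m - y ^ t • m' ∈ J t • (⊤ : Submodule R M) := by
      apply h.mem_of_eq_zero
      rw [mk₀_ofHom_toSpanSingleton_sub, sub_eq_add_neg, Ext.comp_add, Ext.comp_neg,
        mk₀_ofHom_toSpanSingleton_smul,
        Ext.comp_smul, ← sub_eq_add_neg, sub_eq_zero, ← smul_f]
      exact hx₂.symm
    rw [← sub_add_cancel m (y ^ t • m'), Submodule.sup_smul]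
    exact add_mem (Submodule.mem_sup_left hx) (Submodule.mem_sup_right
      (Submodule.smul_mem_smul (Ideal.mem_span_singleton_self _) trivial))
  · intro t s hts hK
    have h1 := ShortComplex.ShortExact.extClass_naturality (hS s) (hS t)
      (quotientMulShortComplexMap y hts (hJ hts) hK)
    rw [← Ext.comp_assoc _ _ _ (zero_add 1) (add_comm 1 j) (by lia)]
    refine (congrArg (fun x ↦ x.comp (ε t) (add_comm 1 j)) h1.symm).trans ?_
    rw [Ext.comp_assoc_of_second_deg_zero, Ext.mk₀_smul, Ext.smul_comp, h.factor_comp t s hts,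
      smul_smul, Ext.comp_smul, mul_pow, mul_comm]
  · intro t M i hi
    obtain ⟨i, rfl⟩ := Nat.exists_eq_succ_of_ne_zero (Nat.ne_zero_of_lt hi)
    have := h.subsingleton t M i (by lia)
    have := h.subsingleton t M (i + 1) (by lia)
    refine subsingleton_of_forall_eq 0 fun x ↦ ?_
    obtain ⟨x₁, rfl⟩ := Ext.contravariant_sequence_exact₃ (hS t) M x (Subsingleton.elim _ _)
      (add_comm 1 i)
    rw [Subsingleton.elim x₁ 0, Ext.comp_zero]

/-- The ideal generated by the `t`-th powers of `x i`, for `i < j`. -/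
def powersIdeal (x : ℕ → R) (j t : ℕ) : Ideal R := Ideal.span ((fun i ↦ x i ^ t) '' Set.Iio j)

lemma powersIdeal_zero (x : ℕ → R) (t : ℕ) : powersIdeal x 0 t = ⊥ := by
  simp [powersIdeal, Set.Iio, Ideal.span]

lemma powersIdeal_succ (x : ℕ → R) (j t : ℕ) :
    powersIdeal x (j + 1) t = powersIdeal x j t ⊔ Ideal.span {x j ^ t} := by
  rw [powersIdeal, powersIdeal, ← Ideal.span_union, ← Set.image_singleton (f := fun i ↦ x i ^ t),
    ← Set.image_union]
  congr 2
  ext i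
  simp

lemma pow_mem_powersIdeal (x : ℕ → R) {i j : ℕ} (h : i < j) (t : ℕ) :
    x i ^ t ∈ powersIdeal x j t :=
  Ideal.subset_span ⟨i, h, rfl⟩

lemma powersIdeal_antitone (x : ℕ → R) (j : ℕ) : Antitone (powersIdeal x j) := by
  rintro t s hts
  rw [powersIdeal, Ideal.span_le]
  rintro _ ⟨i, hi, rfl⟩
  exact (powersIdeal x j t).pow_mem_of_pow_mem (pow_mem_powersIdeal x hi t) hts

lemma powersIdeal_le_pow (x : ℕ → R) (j t : ℕ) : powersIdeal x j t ≤ powersIdeal x j 1 ^ t := by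
  rw [powersIdeal, Ideal.span_le]
  rintro _ ⟨i, hi, rfl⟩
  exact Ideal.pow_mem_pow (by simpa using pow_mem_powersIdeal x hi 1) t

lemma exists_pow_le_powersIdeal (x : ℕ → R) (j t : ℕ) :
    ∃ s, powersIdeal x j 1 ^ s ≤ powersIdeal x j t := by
  apply Ideal.exists_pow_le_of_le_radical_of_fg
  · rw [powersIdeal, Ideal.span_le]
    rintro _ ⟨i, hi, rfl⟩
    exact ⟨t, by simpa using pow_mem_powersIdeal x hi t⟩
  · exact Submodule.fg_span ((Set.finite_Iio j).image _)

lemma exists_isExtGeneratingSystem_powersIdeal (x : ℕ → R) (n : ℕ)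
    (hx : ∀ j < n, ∀ t r, x j ^ t * r ∈ powersIdeal x j t → r ∈ powersIdeal x j t) :
    ∃ ε, IsExtGeneratingSystem (powersIdeal x n) (∏ i ∈ Finset.range n, x i) n ε := by
  induction n with
  | zero => simpa using exists_isExtGeneratingSystem_of_eq_bot (powersIdeal_zero x)
  | succ n ih =>
    obtain ⟨ε, hε⟩ := ih fun j hj ↦ hx j (by lia)
    rw [Finset.prod_range_succ, funext (powersIdeal_succ x n)]
    exact hε.exists_sup_span_pow (powersIdeal_antitone x n) (x n) (hx n (by lia))

/-- The top local cohomology of `M` at a (strongly) regular sequence is the direct limit of the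
modules `M / (x₁ ^ t, …, xₙ ^ t) M`, with transition maps the multiplication by `x₁ ⋯ xₙ`. -/
theorem localCohomology.subsingleton_obj_iff_of_regular (x : ℕ → R) (n : ℕ)
    (hx : ∀ j < n, ∀ t r, x j ^ t * r ∈ powersIdeal x j t → r ∈ powersIdeal x j t)
    (M : ModuleCat.{u} R) :
    Subsingleton ((localCohomology (powersIdeal x n 1) n).obj M) ↔
      ∀ (t : ℕ) (m : M), ∃ s ≥ t,
        (∏ i ∈ Finset.range n, x i) ^ (s - t) • m ∈ powersIdeal x n s • (⊤ : Submodule R M) := by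
  obtain ⟨ε, hε⟩ := exists_isExtGeneratingSystem_powersIdeal x n hx
  rw [← hε.extColimitVanishes_iff (powersIdeal_antitone x n),
    ← extColimitVanishes_iff_of_cofinal (J := fun t ↦ powersIdeal x n 1 ^ t)
      (fun _ _ ↦ Ideal.pow_le_pow_right) (powersIdeal_antitone x n)
      (exists_pow_le_powersIdeal x n) (fun t ↦ ⟨t, powersIdeal_le_pow x n t⟩)]
  exact localCohomology.subsingleton_obj_iff _ n M

lemma Ideal.Quotient.mk_mem_smul_top_iff {J K : Ideal R} {r : R} :
    (Submodule.Quotient.mk r : R ⧸ K) ∈ J • (⊤ : Submodule R (R ⧸ K)) ↔ r ∈ J ⊔ K := by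
  rw [← Submodule.range_mkQ, ← Submodule.map_top, ← Submodule.map_smul'', ← Submodule.mkQ_apply,
    ← Submodule.mem_comap, Submodule.comap_map_mkQ, smul_eq_mul, Ideal.mul_top, sup_comm]

theorem localCohomology.subsingleton_obj_quotient_iff_of_regular (x : ℕ → R) (n : ℕ)
    (hx : ∀ j < n, ∀ t r, x j ^ t * r ∈ powersIdeal x j t → r ∈ powersIdeal x j t) (K : Ideal R) :
    Subsingleton ((localCohomology (powersIdeal x n 1) n).obj (ModuleCat.of R (R ⧸ K))) ↔
      ∀ t : ℕ, ∃ s ≥ t, (∏ i ∈ Finset.range n, x i) ^ (s - t) ∈ powersIdeal x n (s + 1) ⊔ K := by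
  rw [localCohomology.subsingleton_obj_iff_of_regular x n hx]
  constructor
  · intro h t
    obtain ⟨s, hs, h⟩ := h (t + 1) (Submodule.Quotient.mk 1)
    obtain ⟨s, rfl⟩ := Nat.exists_eq_add_of_lt hs
    refine ⟨t + s, by lia, ?_⟩
    rw [← Submodule.Quotient.mk_smul, smul_eq_mul, mul_one,
      Ideal.Quotient.mk_mem_smul_top_iff] at h
    convert h using 2
    lia
  · intro h t m
    obtain ⟨r, rfl⟩ := Submodule.Quotient.mk_surjective _ m
    obtain ⟨s, hs, h⟩ := h t
    refine ⟨s + 1, by lia, ?_⟩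
    rw [← Submodule.Quotient.mk_smul, smul_eq_mul, Nat.sub_add_comm hs, pow_succ, mul_assoc]
    exact Ideal.Quotient.mk_mem_smul_top_iff.2 (Ideal.mul_mem_right _ _ h)

end RegularSequence

lemma Matrix.exists_mul_eq_one_of_residue_mulVec_injective {T : Type*} [CommRing T]
    [IsLocalRing T] {D B : Type*} [Fintype D] [Fintype B] [DecidableEq D] [DecidableEq B]
    (A : Matrix D B T)
    (h : ∀ c, (A.map (IsLocalRing.residue T)).mulVec c = 0 → c = 0) :
    ∃ G : Matrix B D T, G * A = 1 := by
  obtain ⟨g, hg⟩ := LinearMap.exists_leftInverse_of_injective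
    (Matrix.toLin' (A.map (IsLocalRing.residue T))) (LinearMap.ker_eq_bot'.2 h)
  obtain ⟨G, hG⟩ : ∃ G : Matrix B D T, G.map (IsLocalRing.residue T) = LinearMap.toMatrix' g := by
    choose l hl using IsLocalRing.residue_surjective (R := T)
    exact ⟨(LinearMap.toMatrix' g).map l, by ext; simp [hl]⟩
  have h1 : (G * A).map (IsLocalRing.residue T) = 1 := by
    rw [Matrix.map_mul, hG, ← LinearMap.toMatrix'_toLin' (A.map _), ← LinearMap.toMatrix'_comp, hg,
      LinearMap.toMatrix'_id]
  have h2 : IsUnit (G * A).det := by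
    refine isUnit_of_map_unit (IsLocalRing.residue T) _ ?_
    rw [RingHom.map_det, RingHom.mapMatrix_apply, h1, Matrix.det_one]
    exact isUnit_one
  exact ⟨(G * A)⁻¹ * G, by rw [Matrix.mul_assoc, Matrix.nonsing_inv_mul _ h2]⟩

open MvPolynomial

section PolynomialRing

variable {T : Type u} [CommRing T] {n : ℕ}

/-- The variables of `MvPolynomial (Fin n) T`, extended by zero to a sequence. -/
noncomputable def MvPolynomial.finX (T : Type u) [CommRing T] (n i : ℕ) : MvPolynomial (Fin n) T :=
  if h : i < n then X ⟨i, h⟩ else 0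

lemma MvPolynomial.finX_of_lt {i : ℕ} (h : i < n) : finX T n i = X ⟨i, h⟩ := dif_pos h

lemma MvPolynomial.mem_powersIdeal_finX_iff {j : ℕ} (hj : j ≤ n) (t : ℕ)
    (r : MvPolynomial (Fin n) T) :
    r ∈ powersIdeal (finX T n) j t ↔ ∀ m ∈ r.support, ∃ i : Fin n, i < j ∧ t ≤ m i := by
  have h : (fun i ↦ finX T n i ^ t) '' Set.Iio j =
      (fun m ↦ monomial m (1 : T)) '' ((fun i : Fin n ↦ Finsupp.single i t) '' {i | i < j}) := by
    ext r
    simp only [Set.image_image, Set.mem_image, Set.mem_Iio, Set.mem_ofPred_eq]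
    constructor
    · rintro ⟨i, hi, rfl⟩
      exact ⟨⟨i, by lia⟩, hi, by rw [finX_of_lt (by lia), X_pow_eq_monomial]⟩
    · rintro ⟨i, hi, rfl⟩
      exact ⟨i, hi, by rw [finX_of_lt i.2, X_pow_eq_monomial]⟩
  rw [powersIdeal, h, mem_ideal_span_monomial_image]
  simp

lemma MvPolynomial.mem_powersIdeal_finX_of_mul_mem {j : ℕ} (hj : j < n) (t : ℕ)
    (r : MvPolynomial (Fin n) T) (hr : finX T n j ^ t * r ∈ powersIdeal (finX T n) j t) :
    r ∈ powersIdeal (finX T n) j t := by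
  rw [mem_powersIdeal_finX_iff hj.le] at hr ⊢
  intro m hm
  obtain ⟨i, hi, h⟩ := hr (Finsupp.single ⟨j, hj⟩ t + m) (by
    rw [mem_support_iff, finX_of_lt hj, X_pow_eq_monomial, coeff_monomial_mul]
    simpa using hm)
  have : (⟨j, hj⟩ : Fin n) ≠ i := by
    rintro rfl
    simp at hi
  refine ⟨i, hi, ?_⟩
  simpa [Finsupp.single_apply, this] using h

lemma MvPolynomial.powersIdeal_finX_one :
    powersIdeal (finX T n) n 1 = Ideal.span (Set.range X) := by
  rw [powersIdeal]
  congr 1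
  ext r
  simp only [pow_one, Set.mem_image, Set.mem_Iio, Set.mem_range]
  constructor
  · rintro ⟨i, hi, rfl⟩
    exact ⟨⟨i, hi⟩, (finX_of_lt hi).symm⟩
  · rintro ⟨i, rfl⟩
    exact ⟨i, i.2, finX_of_lt i.2⟩

lemma MvPolynomial.prod_finX_pow (k : ℕ) :
    (∏ i ∈ Finset.range n, finX T n i) ^ k =
      monomial (Finsupp.equivFunOnFinite.symm fun _ ↦ k) 1 := by
  rw [Finset.prod_range, ← Finset.prod_pow, monomial_eq, Finsupp.prod_fintype _ _ (by simp)]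
  simp [finX_of_lt]

/-- The top local cohomology of `T[x₁, …, xₙ] ⧸ K` vanishes if and only if, for all `t`, some
`g ∈ K` agrees with a power `(x₁ ⋯ xₙ) ^ (s - t)` in all exponents bounded by `s`. -/
theorem MvPolynomial.subsingleton_localCohomology_quotient_iff
    (K : Ideal (MvPolynomial (Fin n) T)) :
    Subsingleton ((localCohomology
        (Ideal.span (Set.range (X : Fin n → MvPolynomial (Fin n) T))) n).obj
          (ModuleCat.of (MvPolynomial (Fin n) T) (MvPolynomial (Fin n) T ⧸ K))) ↔
      ∀ t : ℕ, ∃ s ≥ t, ∃ g ∈ K, ∀ m : Fin n →₀ ℕ, (∀ i, m i ≤ s) →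
        coeff m g = coeff m (monomial (Finsupp.equivFunOnFinite.symm fun _ ↦ s - t) (1 : T)) := by
  rw [← powersIdeal_finX_one, localCohomology.subsingleton_obj_quotient_iff_of_regular _ _
    fun j hj ↦ mem_powersIdeal_finX_of_mul_mem hj]
  refine forall_congr' fun t ↦ exists_congr fun s ↦ and_congr_right fun _ ↦ ?_
  rw [prod_finX_pow]
  have hmem (g r : MvPolynomial (Fin n) T) : r - g ∈ powersIdeal (finX T n) n (s + 1) ↔
      ∀ m : Fin n →₀ ℕ, (∀ i, m i ≤ s) → coeff m g = coeff m r := by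
    rw [mem_powersIdeal_finX_iff le_rfl]
    refine forall_congr' fun m ↦ ?_
    rw [mem_support_iff, coeff_sub, ne_eq, sub_eq_zero, ← not_imp_not, not_not, eq_comm]
    simp
  constructor
  · intro h
    obtain ⟨y, hy, g, hg, h⟩ := Submodule.mem_sup.1 h
    exact ⟨g, hg, (hmem _ _).1 (by rwa [← h, add_sub_cancel_right])⟩
  · rintro ⟨g, hg, h⟩
    rw [← sub_add_cancel (monomial _ _) g]
    exact add_mem (Submodule.mem_sup_left ((hmem _ _).2 h)) (Submodule.mem_sup_right hg)

/-- If the homogeneous polynomial `f` is nonzero modulo the maximal ideal, then the coefficient of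
`b₀` is, on forms of the degree of `b₀`, a combination of the coefficients of the product by `f`. -/
lemma MvPolynomial.exists_sum_coeff_mul_monomial_eq [IsLocalRing T] {f : MvPolynomial (Fin n) T}
    {p : ℕ} (hf : f.IsHomogeneous p) (hf0 : map (IsLocalRing.residue T) f ≠ 0) (b₀ : Fin n →₀ ℕ) :
    ∃ (D : Finset (Fin n →₀ ℕ)) (v : (Fin n →₀ ℕ) → T), (∀ a ∈ D, a.degree = p + b₀.degree) ∧
      ∀ b, ∑ a ∈ D, v a * coeff a (f * monomial b 1) = if b = b₀ then 1 else 0 := by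
  have hmem (N : ℕ) (a : Fin n →₀ ℕ) :
      a ∈ Finset.finsuppAntidiag Finset.univ N ↔ a.degree = N := by
    simp [Finset.mem_finsuppAntidiag, Finsupp.degree_eq_sum]
  let D := Finset.finsuppAntidiag (Finset.univ : Finset (Fin n)) (p + b₀.degree)
  let B := Finset.finsuppAntidiag (Finset.univ : Finset (Fin n)) b₀.degree
  obtain ⟨G, hG⟩ := Matrix.exists_mul_eq_one_of_residue_mulVec_injective
    (Matrix.of fun (a : D) (b : B) ↦ coeff a.1 (f * monomial b.1 1)) fun c hc ↦ by
      let q : MvPolynomial (Fin n) (IsLocalRing.ResidueField T) := ∑ b : B, monomial b.1 (c b)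
      have hq : q.IsHomogeneous b₀.degree :=
        IsHomogeneous.sum _ _ _ fun b _ ↦ isHomogeneous_monomial _ ((hmem _ _).1 b.2)
      have hfq : map (IsLocalRing.residue T) f * q = 0 := by
        ext a
        rw [coeff_zero]
        by_cases ha : a.degree = p + b₀.degree
        · refine Eq.trans ?_ (congrFun hc ⟨a, (hmem _ _).2 ha⟩)
          rw [Finset.mul_sum, coeff_sum]
          refine Finset.sum_congr rfl fun b _ ↦ ?_
          change _ = IsLocalRing.residue T (coeff a (f * monomial b.1 1)) * c b
          rw [← coeff_map, map_mul, map_monomial, map_one, coeff_mul_monomial', coeff_mul_monomial']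
          split_ifs <;> simp
        · exact ((hf.map _).mul hq).coeff_eq_zero ha
      have hq0 := (mul_eq_zero.1 hfq).resolve_left hf0
      ext b
      have := congrArg (coeff b.1) hq0
      simpa [q, coeff_sum, coeff_monomial, Subtype.coe_inj] using this
  have hb₀ : b₀ ∈ B := (hmem _ _).2 rfl
  refine ⟨D, fun a ↦ if ha : a ∈ D then G ⟨b₀, hb₀⟩ ⟨a, ha⟩ else 0, fun a ha ↦ (hmem _ _).1 ha,
    fun b ↦ ?_⟩
  by_cases hb : b.degree = b₀.degree
  · have h1 := congrFun (congrFun hG ⟨b₀, hb₀⟩) ⟨b, (hmem _ _).2 hb⟩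
    rw [← Finset.sum_coe_sort]
    simpa [Matrix.mul_apply, Matrix.one_apply, eq_comm] using h1
  · rw [if_neg (by rintro rfl; exact hb rfl)]
    refine Finset.sum_eq_zero fun a ha ↦ ?_
    rw [(hf.mul (isHomogeneous_monomial (1 : T) rfl)).coeff_eq_zero, mul_zero]
    have := (hmem _ _).1 ha
    lia

lemma MvPolynomial.coeff_mul_monomial_tsub {m a S : Fin n →₀ ℕ} (hm : m ≤ S) (ha : a ≤ S)
    (f : MvPolynomial (Fin n) T) (r : T) :
    coeff m (f * monomial (S - a) r) = r * coeff a (f * monomial (S - m) 1) := by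
  have h1 : S - a ≤ m ↔ S - m ≤ a := by rw [tsub_le_iff_left, tsub_le_iff_right]
  have h2 : m - (S - a) = a - (S - m) := by
    ext i
    have := hm i
    have := ha i
    simp only [Finsupp.tsub_apply]
    lia
  simp only [coeff_mul_monomial', h1, h2]
  split_ifs <;> simp [mul_comm]

lemma MvPolynomial.coeff_mul_mem_span_coeff (f h : MvPolynomial (Fin n) T) (m : Fin n →₀ ℕ) :
    coeff m (f * h) ∈ Ideal.span ((fun m ↦ coeff m f) '' (f.support : Set (Fin n →₀ ℕ))) := by
  rw [coeff_mul]
  refine sum_mem fun a _ ↦ Ideal.mul_mem_right _ _ ?_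
  by_cases ha : a.1 ∈ f.support
  · exact Ideal.subset_span ⟨a.1, ha, rfl⟩
  · rw [notMem_support_iff.1 ha]
    exact zero_mem _

lemma MvPolynomial.exists_mem_span_singleton_coeff_eq [IsLocalRing T] {f : MvPolynomial (Fin n) T}
    {p : ℕ} (hf : f.IsHomogeneous p) (hf0 : map (IsLocalRing.residue T) f ≠ 0) (t : ℕ) :
    ∃ s ≥ t, ∃ g ∈ Ideal.span {f}, ∀ m : Fin n →₀ ℕ, (∀ i, m i ≤ s) →
      coeff m g = coeff m (monomial (Finsupp.equivFunOnFinite.symm fun _ ↦ s - t) (1 : T)) := by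
  let cst (k : ℕ) : Fin n →₀ ℕ := Finsupp.equivFunOnFinite.symm fun _ ↦ k
  obtain ⟨D, v, hD, hv⟩ := exists_sum_coeff_mul_monomial_eq hf hf0 (cst t)
  let s := p + (cst t).degree + t
  refine ⟨s, by lia, f * ∑ a ∈ D, monomial (cst s - a) (v a),
    Ideal.mul_mem_right _ _ (Ideal.mem_span_singleton_self f), fun m hm ↦ ?_⟩
  have hm' : m ≤ cst s := hm
  have hDs (a) (ha : a ∈ D) : a ≤ cst s := fun i ↦ by
    have := hD a ha
    have := Finsupp.le_degree i a
    change a i ≤ s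
    lia
  rw [Finset.mul_sum, coeff_sum,
    Finset.sum_congr rfl fun a ha ↦ coeff_mul_monomial_tsub hm' (hDs a ha) f (v a), hv,
    coeff_monomial]
  refine if_congr ⟨fun h ↦ ?_, fun h ↦ ?_⟩ rfl rfl
  · ext i
    have h1 := DFunLike.congr_fun h i
    have h2 := hm i
    change s - t = m i
    change s - m i = t at h1
    lia
  · ext i
    have h1 := DFunLike.congr_fun h i
    have h2 := hm i
    change s - t = m i at h1
    change s - m i = t
    lia

lemma MvPolynomial.map_residue_ne_zero_of_span_coeff_eq_top [IsLocalRing T]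
    {f : MvPolynomial (Fin n) T}
    (h : Ideal.span ((fun m ↦ coeff m f) '' (f.support : Set (Fin n →₀ ℕ))) = ⊤) :
    map (IsLocalRing.residue T) f ≠ 0 := by
  intro h0
  refine (IsLocalRing.maximalIdeal.isMaximal T).ne_top (top_le_iff.1 (h ▸ Ideal.span_le.2 ?_))
  rintro _ ⟨m, -, rfl⟩
  rw [SetLike.mem_coe, ← IsLocalRing.residue_eq_zero_iff, ← coeff_map, h0, coeff_zero]

end PolynomialRing

/-- Let `(T, m)` be a Noetherian local ring, `R = T[x₁,…,xₙ]`, `I = (x₁,…,xₙ)R`, `f ∈ R`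
homogeneous, and `C_f ⊆ T` the ideal generated by the (nonzero) coefficients of `f`.
Then `Hⁿ_I(R/fR) = 0` if and only if `C_f = T`. -/
theorem top_localCohomology_eq_zero_iff
    {T : Type} [CommRing T] [IsLocalRing T] [IsNoetherianRing T]
    (n : ℕ) (f : MvPolynomial (Fin n) T) (p : ℕ) (hf : f.IsHomogeneous p) :
    letI R := MvPolynomial (Fin n) T
    letI I : Ideal R := Ideal.span (Set.range (X : Fin n → R))
    (Subsingleton ((localCohomology I n).obj
        (ModuleCat.of (MvPolynomial (Fin n) T) (MvPolynomial (Fin n) T ⧸ Ideal.span {f})))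
      ↔ Ideal.span ((fun m => MvPolynomial.coeff m f) '' ↑f.support) = (⊤ : Ideal T)) := by
  refine (subsingleton_localCohomology_quotient_iff (Ideal.span {f})).trans ⟨fun h ↦ ?_, fun h t ↦
    exists_mem_span_singleton_coeff_eq hf (map_residue_ne_zero_of_span_coeff_eq_top h) t⟩
  obtain ⟨s, -, g, hg, h⟩ := h 0
  obtain ⟨r, rfl⟩ := Ideal.mem_span_singleton.1 hg
  rw [Ideal.eq_top_iff_one]
  have h1 := h (Finsupp.equivFunOnFinite.symm fun _ ↦ s) fun _ ↦ le_rfl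
  rw [Nat.sub_zero, coeff_monomial, if_pos rfl] at h1
  rw [← h1]
  exact coeff_mul_mem_span_coeff f r _
end

section
/- Let (T,m) be a Noetherian local ring and u, v ∈ T elements such that the ideal (u,v)T has height 2. For each integer n ≥ 1, let M_n be the cokernel of the T-linear map φ_n : T^{n+1} → T^n represented by the n × (n+1) bidiagonal matrix A_n with entries (A_n)_{i,i} = u, (A_n)_{i,i+1} = v, and 0 elsewhere. Let J = ∩_{n ≥ 1} ann_T M_n. Then dim T/J = dim T. -/
/-- The `n × (n+1)` bidiagonal matrix with `u` on the main diagonal and `v` on the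
superdiagonal. -/
def bidiagMatrix {T : Type} [CommRing T] (u v : T) (n : ℕ) :
    Matrix (Fin n) (Fin (n + 1)) T :=
  Matrix.of fun i j =>
    if (j : ℕ) = (i : ℕ) then u else if (j : ℕ) = (i : ℕ) + 1 then v else 0

/-- The cokernel `M_n` of the map `T^{n+1} → T^n` given by the bidiagonal matrix `A_n`. -/
abbrev bidiagCoker {T : Type} [CommRing T] (u v : T) (n : ℕ) :=
  (Fin n → T) ⧸ LinearMap.range (Matrix.mulVecLin (bidiagMatrix u v n))

/-- The height of an ideal: the infimum of the heights of the prime ideals containing it. -/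
noncomputable def idealHeight {T : Type} [CommRing T] (I : Ideal T) : WithTop ℕ :=
  ⨅ p ∈ { p : PrimeSpectrum T | I ≤ p.asIdeal }, Order.height p

/-- If every prime between `I` and `q` contains `x`, then `x` is nilpotent in `(R ⧸ I)_q`. -/
theorem Ideal.exists_pow_mul_mem_of_forall_isPrime {R : Type*} [CommRing R] {I q : Ideal R}
    [q.IsPrime] {x : R} (h : ∀ P : Ideal R, P.IsPrime → I ≤ P → P ≤ q → x ∈ P) :
    ∃ y ∉ q, ∃ n : ℕ, x ^ n * y ∈ I := by
  by_contra! H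
  obtain ⟨P, hP, hIP, hd⟩ := I.exists_le_prime_disjoint (Submonoid.powers x ⊔ q.primeCompl) <| by
    rw [Set.disjoint_left]
    rintro z hz hz'
    obtain ⟨_, ⟨n, rfl⟩, y, hy, rfl⟩ := Submonoid.mem_sup.mp hz'
    exact H y hy n hz
  rw [Set.disjoint_left] at hd
  have hPq : P ≤ q := fun z hz ↦ by
    by_contra hzq
    exact hd hz (Submonoid.mem_sup_right hzq)
  exact hd (h P hP hIP hPq) (Submonoid.mem_sup_left (Submonoid.mem_powers x))

/-- If no chain `p₀ < p₁ < q` of primes lies above `J`, then `(R ⧸ J)_q` has dimension at most one,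
so its second local cohomology with respect to `(u, v)` vanishes. -/
theorem Ideal.exists_mul_pow_mem_of_forall_not_lt {R : Type*} [CommRing R]
    {J q : Ideal R} [q.IsPrime] {u v : R} (hv : v ∈ q)
    (h : ∀ p₀ p₁ : Ideal R, p₀.IsPrime → p₁.IsPrime → J ≤ p₀ → p₀ < p₁ → ¬ p₁ < q) :
    ∃ w ∉ q, ∃ (t : ℕ) (a c : R), c ∈ J ∧ w * (u * v) ^ t = a * u ^ (t + 1) + c := by
  let K : Ideal R :=
    { carrier := {x | ∃ i, x * u ^ i ∈ J}
      zero_mem' := ⟨0, by simp⟩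
      add_mem' := by
        rintro x y ⟨i, hi⟩ ⟨j, hj⟩
        refine ⟨i + j, ?_⟩
        have := J.add_mem (J.mul_mem_right (u ^ j) hi) (J.mul_mem_right (u ^ i) hj)
        convert this using 1
        ring
      smul_mem' := by
        rintro c x ⟨i, hi⟩
        exact ⟨i, by simpa [mul_assoc] using J.mul_mem_left c hi⟩ }
  have key : ∀ P : Ideal R, P.IsPrime → K ⊔ Ideal.span {u} ≤ P → P ≤ q → v ∈ P := by
    intro P hP hIP hPq
    by_contra hvP
    have hlt : P < q := lt_of_le_of_ne hPq (by rintro rfl; exact hvP hv)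
    have huP : u ∈ P := hIP (Ideal.mem_sup_right (Ideal.mem_span_singleton_self u))
    have hKP : K ≤ P := le_sup_left.trans hIP
    obtain ⟨y, hy, n, hn⟩ := Ideal.exists_pow_mul_mem_of_forall_isPrime (I := J) (q := P) (x := u)
      fun P' hP' hJP' hle ↦ by
        rcases hle.eq_or_lt with rfl | hl
        · exact huP
        · exact (h P' P hP' hP hJP' hl hlt).elim
    exact hy (hKP ⟨n, by rwa [mul_comm]⟩)
  obtain ⟨w, hw, j, hj⟩ := Ideal.exists_pow_mul_mem_of_forall_isPrime key
  obtain ⟨κ, ⟨i, hi⟩, e, he, hsum⟩ := Submodule.mem_sup.mp hj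
  obtain ⟨e, rfl⟩ := Ideal.mem_span_singleton'.mp he
  refine ⟨w, hw, i + j, e * v ^ i, κ * u ^ i * u ^ j * v ^ i,
    J.mul_mem_right _ (J.mul_mem_right _ hi), ?_⟩
  calc w * (u * v) ^ (i + j) = (v ^ j * w) * (u ^ (i + j) * v ^ i) := by ring
    _ = _ := by rw [← hsum]; ring

theorem isArtinian_of_forall_smul_eq_zero {R M : Type*} [CommRing R] [AddCommGroup M] [Module R M]
    [Module.Finite R M] (I : Ideal R) [IsArtinianRing (R ⧸ I)]
    (h : ∀ r ∈ I, ∀ x : M, r • x = 0) : IsArtinian R M := by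
  have hM : Module.IsTorsionBySet R M I := fun x r ↦ h r r.2 x
  let := hM.module
  have : IsScalarTower R (R ⧸ I) M := hM.isScalarTower
  have : Module.Finite (R ⧸ I) M := Module.Finite.of_restrictScalars_finite R _ _
  exact isArtinian_of_surjective_algebraMap (S := R) (R := R ⧸ I) Ideal.Quotient.mk_surjective

theorem Module.length_quotient_range_eq_length_ker {R M : Type*} [CommRing R] [AddCommGroup M]
    [Module R M] [IsArtinian R M] [IsNoetherian R M] (f : M →ₗ[R] M) :
    Module.length R (M ⧸ LinearMap.range f) = Module.length R (LinearMap.ker f) := by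
  have h₁ := Module.length_eq_add_of_exact (LinearMap.range f).subtype (LinearMap.range f).mkQ
    (Submodule.subtype_injective _) (Submodule.mkQ_surjective _)
    (LinearMap.exact_subtype_mkQ _)
  have h₂ := Module.length_eq_add_of_exact (LinearMap.ker f).subtype f.rangeRestrict
    (Submodule.subtype_injective _) f.surjective_rangeRestrict
    (by rw [LinearMap.exact_iff, Submodule.range_subtype, LinearMap.ker_rangeRestrict])
  have hfin : Module.length R (LinearMap.range f) ≠ ⊤ := Module.length_ne_top
  rw [h₁, add_comm] at h₂
  exact WithTop.add_right_cancel hfin h₂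

theorem Order.natCast_le_coheight_of_forall_lt {α : Type*} [Preorder α] (f : ℕ → α) (n : ℕ)
    (h : ∀ i < n, f i < f (i + 1)) : (n : ℕ∞) ≤ Order.coheight (f 0) := by
  induction n generalizing f with
  | zero => simp
  | succ n ih =>
    have h₁ := ih (fun i ↦ f (i + 1)) fun i hi ↦ h (i + 1) (by lia)
    have h₂ := Order.coheight_add_one_le (h 0 (by lia))
    push_cast
    exact (add_le_add_left h₁ 1).trans h₂

/-- The saturation of `(u ^ k)` with respect to `v`. -/
def powSaturation {R : Type*} [CommRing R] (u v : R) (k : ℕ) : Ideal R where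
  carrier := {x | ∃ N : ℕ, u ^ k ∣ v ^ N * x}
  zero_mem' := ⟨0, by simp⟩
  add_mem' := by
    rintro x y ⟨M, hM⟩ ⟨N, hN⟩
    refine ⟨M + N, ?_⟩
    have h := dvd_add (hM.mul_left (v ^ N)) (hN.mul_left (v ^ M))
    convert h using 1
    ring
  smul_mem' := by
    rintro c x ⟨N, hN⟩
    exact ⟨N, by simpa [mul_left_comm] using hN.mul_left c⟩

section powSaturation

variable {R : Type*} [CommRing R] {u v : R}

theorem pow_mem_powSaturation (k : ℕ) : u ^ k ∈ powSaturation u v k := ⟨0, by simp⟩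

theorem mul_mem_powSaturation {k l : ℕ} {x y : R} (hx : x ∈ powSaturation u v k)
    (hy : y ∈ powSaturation u v l) : x * y ∈ powSaturation u v (k + l) := by
  obtain ⟨M, hM⟩ := hx
  obtain ⟨N, hN⟩ := hy
  refine ⟨M + N, ?_⟩
  rw [pow_add, pow_add, mul_mul_mul_comm]
  exact mul_dvd_mul hM hN

theorem pow_mem_powSaturation_mul {k : ℕ} {x : R} (hx : x ∈ powSaturation u v k) (i : ℕ) :
    x ^ i ∈ powSaturation u v (k * i) := by
  induction i with
  | zero => simpa using pow_mem_powSaturation (u := u) (v := v) 0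
  | succ i ih =>
    rw [pow_succ, mul_add, mul_one]
    exact mul_mem_powSaturation ih hx

/-- The image of `powSaturation u v k` in `R ⧸ (u ^ k)`, that is, the `v`-power torsion. -/
def powSaturationQuotient (u v : R) (k : ℕ) : Submodule R (R ⧸ Ideal.span {u ^ k}) :=
  Submodule.map (Ideal.span {u ^ k}).mkQ (powSaturation u v k)

theorem mkQ_mem_powSaturationQuotient {k : ℕ} {x : R} :
    (Ideal.span {u ^ k}).mkQ x ∈ powSaturationQuotient u v k ↔ x ∈ powSaturation u v k := by
  rw [powSaturationQuotient, ← Submodule.mem_comap, Submodule.comap_map_mkQ,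
    sup_eq_right.mpr ((Ideal.span_singleton_le_iff_mem _).mpr (pow_mem_powSaturation k))]

/-- The ideals `(b ^ i * u ^ (k - t * i)) + powSaturation u v (k + 1)`, viewed inside
`powSaturationQuotient u v k`. They correspond to the fractions `(b / u ^ t) ^ i`. -/
def powSaturationChain (u v b : R) (k t i : ℕ) : Submodule R (powSaturationQuotient u v k) :=
  Submodule.comap (powSaturationQuotient u v k).subtype (Submodule.map (Ideal.span {u ^ k}).mkQ
    (Ideal.span {b ^ i * u ^ (k - t * i)} ⊔ powSaturation u v (k + 1)))

theorem range_lsmul_le_powSaturationChain_zero {b : R} {k t : ℕ} :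
    LinearMap.range (LinearMap.lsmul R (powSaturationQuotient u v k) u) ≤
      powSaturationChain u v b k t 0 := by
  rintro _ ⟨⟨_, x, hx, rfl⟩, rfl⟩
  refine ⟨u * x, Ideal.mem_sup_right ?_, rfl⟩
  rw [add_comm]
  exact mul_mem_powSaturation (by simpa using pow_mem_powSaturation (u := u) (v := v) 1) hx

theorem isArtinian_powSaturationQuotient [IsNoetherianRing R] [IsLocalRing R]
    (hm : IsLocalRing.maximalIdeal R ∈ (Ideal.span {u, v}).minimalPrimes) (k : ℕ) :
    IsArtinian R (powSaturationQuotient u v (k + 1)) := by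
  let H := powSaturationQuotient u v (k + 1)
  obtain ⟨N, hN⟩ := monotone_stabilizes_iff_noetherian.mpr (inferInstanceAs (IsNoetherian R H))
    ⟨fun n ↦ Submodule.torsionBy R H (v ^ n), fun m n hmn ↦
      Submodule.torsionBy_le_torsionBy_of_dvd _ _ (pow_dvd_pow v hmn)⟩
  have htors : ∀ x : H, v ^ N • x = 0 := by
    rintro ⟨_, x, ⟨n, hn⟩, rfl⟩
    have hx : (⟨_, x, ⟨n, hn⟩, rfl⟩ : H) ∈ Submodule.torsionBy R H (v ^ (N + n)) := by
      rw [Submodule.mem_torsionBy_iff]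
      refine Subtype.ext ?_
      change (Ideal.span {u ^ (k + 1)}).mkQ (v ^ (N + n) * x) = 0
      rw [Submodule.mkQ_apply, Submodule.Quotient.mk_eq_zero, Ideal.mem_span_singleton,
        pow_add v N n, mul_assoc]
      exact hn.mul_left _
    have hNn : Submodule.torsionBy R H (v ^ N) = Submodule.torsionBy R H (v ^ (N + n)) :=
      hN (N + n) (Nat.le_add_right N n)
    rwa [← hNn] at hx
  have hle : IsLocalRing.maximalIdeal R ∈ (Ideal.span {u ^ (k + 1), v ^ (N + 1)}).minimalPrimes := by
    refine ⟨⟨inferInstance, ?_⟩, ?_⟩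
    · rw [Ideal.span_le, Set.insert_subset_iff, Set.singleton_subset_iff]
      exact ⟨Ideal.pow_mem_of_mem _ (hm.1.2 (Ideal.subset_span (by simp))) _ k.succ_pos,
        Ideal.pow_mem_of_mem _ (hm.1.2 (Ideal.subset_span (by simp))) _ N.succ_pos⟩
    · rintro P ⟨hP, hPuv⟩ hPm
      refine hm.2 ⟨hP, ?_⟩ hPm
      rw [Ideal.span_le, Set.insert_subset_iff, Set.singleton_subset_iff] at hPuv ⊢
      exact ⟨hP.mem_of_pow_mem _ hPuv.1, hP.mem_of_pow_mem _ hPuv.2⟩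
  have := IsLocalRing.quotient_artinian_of_mem_minimalPrimes_of_isLocalRing _ hle
  refine isArtinian_of_forall_smul_eq_zero (Ideal.span {u ^ (k + 1), v ^ (N + 1)}) fun r hr x ↦ ?_
  obtain ⟨a, b, rfl⟩ := Ideal.mem_span_pair.mp hr
  have hu : u ^ (k + 1) • x = 0 := by
    obtain ⟨_, x, hx, rfl⟩ := x
    refine Subtype.ext ?_
    change (Ideal.span {u ^ (k + 1)}).mkQ (u ^ (k + 1) * x) = 0
    rw [Submodule.mkQ_apply, Submodule.Quotient.mk_eq_zero]
    exact Ideal.mul_mem_right _ _ (Ideal.mem_span_singleton_self _)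
  rw [add_smul, mul_smul, mul_smul, hu, pow_succ' v N, mul_smul, htors, smul_zero, smul_zero,
    smul_zero, add_zero]

variable [IsDomain R]

theorem length_ker_lsmul_powSaturationQuotient_le {k : ℕ} (hu : u ≠ 0) :
    Module.length R (LinearMap.ker (LinearMap.lsmul R (powSaturationQuotient u v (k + 1)) u)) ≤
      Module.length R (powSaturationQuotient u v 1) := by
  let g : (R ⧸ Ideal.span {u ^ 1}) →ₗ[R] R ⧸ Ideal.span {u ^ (k + 1)} :=
    Submodule.mapQ _ _ (LinearMap.lsmul R R (u ^ k)) <| by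
      refine (Ideal.span_singleton_le_iff_mem _).mpr ?_
      simp [pow_succ]
  set f := LinearMap.lsmul R (powSaturationQuotient u v (k + 1)) u
  have hle : (LinearMap.ker f).map (powSaturationQuotient u v (k + 1)).subtype ≤
      (powSaturationQuotient u v 1).map g := by
    rintro _ ⟨⟨_, x, ⟨N, hN⟩, rfl⟩, hx, rfl⟩
    have hx' : u • (Ideal.span {u ^ (k + 1)}).mkQ x = 0 := congrArg Subtype.val hx
    rw [← map_smul, Submodule.mkQ_apply, Submodule.Quotient.mk_eq_zero, smul_eq_mul,
      Ideal.mem_span_singleton, pow_succ', mul_dvd_mul_iff_left hu] at hx'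
    obtain ⟨y, rfl⟩ := hx'
    rw [mul_left_comm, pow_succ, mul_dvd_mul_iff_left (pow_ne_zero k hu)] at hN
    exact ⟨_, mkQ_mem_powSaturationQuotient.mpr ⟨N, by rwa [pow_one]⟩, rfl⟩
  calc _ = Module.length R ((LinearMap.ker f).map (powSaturationQuotient u v (k + 1)).subtype) :=
        (Submodule.equivMapOfInjective _ (Submodule.subtype_injective _) _).length_eq
    _ ≤ Module.length R ((powSaturationQuotient u v 1).map g) :=
        Module.length_le_of_injective _ (Submodule.inclusion_injective hle)
    _ ≤ _ := Module.length_le_of_surjective _ (g.submoduleMap_surjective _)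

variable [IsLocalRing R]

theorem powSaturationChain_lt {b r : R} {k t i : ℕ} (hu : u ≠ 0)
    (hv : v ∈ IsLocalRing.maximalIdeal R) (huv : ∀ N : ℕ, ¬ u ∣ v ^ N)
    (h : (u * v) ^ t = r * u ^ (t + 1) + b * v ^ (t + 1)) (hk : t * (i + 1) ≤ k) :
    powSaturationChain u v b k t i < powSaturationChain u v b k t (i + 1) := by
  have hb : b ∈ powSaturation u v t :=
    ⟨t + 1, v ^ t - r * u, by linear_combination -h⟩
  have hbv : v * b - u ^ t ∈ powSaturation u v (t + 1) :=
    ⟨t, -r, by linear_combination -h⟩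
  have hstep : ∀ j, t * (j + 1) ≤ k →
      v * (b ^ (j + 1) * u ^ (k - t * (j + 1))) - b ^ j * u ^ (k - t * j) ∈
        powSaturation u v (k + 1) := by
    intro j hj
    have h1 := mul_mem_powSaturation (mul_mem_powSaturation (pow_mem_powSaturation_mul hb j)
      (pow_mem_powSaturation (v := v) (k - t * (j + 1)))) hbv
    have h2 : k - t * j = (k - t * (j + 1)) + t := by rw [mul_add] at *; lia
    have h3 : t * j + (k - t * (j + 1)) + (t + 1) = k + 1 := by rw [mul_add] at *; lia
    rw [h3] at h1
    convert h1 using 1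
    rw [h2]
    ring
  have hiter : ∀ j, t * j ≤ k →
      v ^ j * (b ^ j * u ^ (k - t * j)) - u ^ k ∈ powSaturation u v (k + 1) := by
    intro j
    induction j with
    | zero => simp
    | succ j ih =>
      intro hj
      have h1 := add_mem (Ideal.mul_mem_left _ (v ^ j) (hstep j hj))
        (ih (by rw [mul_add] at hj; lia))
      convert h1 using 1
      ring
  have hle : Ideal.span {b ^ i * u ^ (k - t * i)} ⊔ powSaturation u v (k + 1) ≤
      Ideal.span {b ^ (i + 1) * u ^ (k - t * (i + 1))} ⊔ powSaturation u v (k + 1) := by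
    refine sup_le ((Ideal.span_singleton_le_iff_mem _).mpr ?_) le_sup_right
    refine Submodule.mem_sup.mpr ⟨v * (b ^ (i + 1) * u ^ (k - t * (i + 1))),
      Ideal.mul_mem_left _ _ (Ideal.mem_span_singleton_self _), _, neg_mem (hstep i hk), ?_⟩
    ring
  refine lt_of_le_not_ge (Submodule.comap_mono (Submodule.map_mono hle)) fun hge ↦ ?_
  have hσ : b ^ (i + 1) * u ^ (k - t * (i + 1)) ∈ powSaturation u v k := by
    have := mul_mem_powSaturation (pow_mem_powSaturation_mul hb (i + 1))
      (pow_mem_powSaturation (u := u) (v := v) (k - t * (i + 1)))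
    rwa [Nat.add_sub_cancel' hk] at this
  obtain ⟨y, hy, hyσ⟩ := @hge ⟨_, mkQ_mem_powSaturationQuotient.mpr hσ⟩
    ⟨_, Ideal.mem_sup_left (Ideal.mem_span_singleton_self _), rfl⟩
  replace hyσ := (Submodule.Quotient.eq _).mp hyσ.symm
  obtain ⟨d, hd⟩ := Ideal.mem_span_singleton'.mp hyσ
  obtain ⟨z, hz, s, hs, rfl⟩ := Submodule.mem_sup.mp hy
  obtain ⟨c, rfl⟩ := Ideal.mem_span_singleton'.mp hz
  have hunit : IsUnit (1 - v * (c + d * v ^ i)) := by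
    by_contra hn
    refine (IsLocalRing.maximalIdeal.isMaximal R).ne_top ((Ideal.eq_top_iff_one _).mpr ?_)
    simpa only [sub_add_cancel] using add_mem ((IsLocalRing.mem_maximalIdeal _).mpr hn)
      (Ideal.mul_mem_right (c + d * v ^ i) _ hv)
  have hmem : (1 - v * (c + d * v ^ i)) * u ^ k ∈ powSaturation u v (k + 1) := by
    have h1 := hiter (i + 1) hk
    have h2 := Ideal.mul_mem_left _ (c * v) (hiter i (by rw [mul_add] at hk; lia))
    have h3 := Ideal.mul_mem_left _ (v ^ (i + 1)) hs
    convert add_mem (sub_mem h2 h1) h3 using 1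
    linear_combination -(v ^ (i + 1)) * hd
  obtain ⟨N, e, he⟩ := (Ideal.unit_mul_mem_iff_mem _ hunit).mp hmem
  refine huv N ⟨e, mul_right_cancel₀ (pow_ne_zero k hu) ?_⟩
  rw [he]
  ring

theorem mul_pow_ne_add_of_one_lt_height [IsNoetherianRing R]
    (hm : IsLocalRing.maximalIdeal R ∈ (Ideal.span {u, v}).minimalPrimes)
    (hht : 1 < (IsLocalRing.maximalIdeal R).height) (t : ℕ) (a b : R) :
    (u * v) ^ t ≠ a * u ^ (t + 1) + b * v ^ (t + 1) := by
  intro h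
  have hprin : ∀ x : R, IsLocalRing.maximalIdeal R ∉ (Ideal.span {x}).minimalPrimes := fun x hx ↦
    have : (Ideal.span {x}).IsPrincipal := ⟨x, rfl⟩
    hht.not_ge (Ideal.height_le_one_of_isPrincipal_of_mem_minimalPrimes _ _ hx)
  have humem : u ∈ IsLocalRing.maximalIdeal R := hm.1.2 (Ideal.subset_span (by simp))
  have hvmem : v ∈ IsLocalRing.maximalIdeal R := hm.1.2 (Ideal.subset_span (by simp))
  have hu : u ≠ 0 := by
    rintro rfl
    refine hprin v ?_
    rwa [Ideal.span_insert_zero] at hm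
  have huv : ∀ N : ℕ, ¬ u ∣ v ^ N := by
    intro N hN
    refine hprin u ⟨⟨inferInstance, (Ideal.span_singleton_le_iff_mem _).mpr humem⟩, ?_⟩
    rintro P ⟨hP, hPu⟩ hPm
    refine hm.2 ⟨hP, ?_⟩ hPm
    have huP := (Ideal.span_singleton_le_iff_mem _).mp hPu
    rw [Ideal.span_le, Set.insert_subset_iff, Set.singleton_subset_iff]
    exact ⟨huP, hP.mem_of_pow_mem N (P.mem_of_dvd hN huP)⟩
  have hart := isArtinian_powSaturationQuotient hm
  have := hart 0
  obtain ⟨C, hC⟩ := ENat.ne_top_iff_exists.mp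
    (Module.length_ne_top (R := R) (M := powSaturationQuotient u v 1))
  have hchain := Order.natCast_le_coheight_of_forall_lt
    (powSaturationChain u v b (t * (C + 1) + 1) t) (C + 1) fun i hi ↦
      powSaturationChain_lt hu hvmem huv h ((Nat.mul_le_mul_left t hi).trans (Nat.le_succ _))
  have hbound := calc
    ((C + 1 : ℕ) : ℕ∞) ≤ _ := hchain
    _ ≤ _ := Order.coheight_anti range_lsmul_le_powSaturationChain_zero
    _ = _ := Module.length_quotient.symm
    _ = _ := Module.length_quotient_range_eq_length_ker _
    _ ≤ _ := length_ker_lsmul_powSaturationQuotient_le hu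
    _ = (C : ℕ∞) := hC.symm
  exact absurd (Nat.cast_le.mp hbound) (by lia)

end powSaturation

/-- Over a minimal prime `q` of `(u, v)` of height at least two, the class of `1 / (u v)` in the
second local cohomology of `(R ⧸ p₀)_q` does not vanish. -/
theorem Ideal.mul_mul_pow_notMem_span_of_mem_minimalPrimes {R : Type*} [CommRing R]
    [IsNoetherianRing R] {q p₀ p₁ : Ideal R} [p₀.IsPrime] [p₁.IsPrime] {u v w : R}
    (hq : q ∈ (Ideal.span {u, v}).minimalPrimes) (h₀ : p₀ < p₁) (h₁ : p₁ < q) (hw : w ∉ q) (t : ℕ) :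
    w * (u * v) ^ t ∉ Ideal.span {u ^ (t + 1), v ^ (t + 1)} := by
  intro hmem
  have hqp : q.IsPrime := hq.1.1
  have hker : ∀ p : Ideal R, p₀ ≤ p → RingHom.ker (Ideal.Quotient.mk p₀) ≤ p := fun p hp ↦ by
    rwa [Ideal.mk_ker]
  have hcomap : ∀ p : Ideal R, p₀ ≤ p →
      (p.map (Ideal.Quotient.mk p₀)).comap (Ideal.Quotient.mk p₀) = p := fun p hp ↦ by
    rw [Ideal.comap_map_of_surjective' _ Ideal.Quotient.mk_surjective, sup_eq_left]
    exact hker p hp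
  let Q := q.map (Ideal.Quotient.mk p₀)
  have hQ : Q.IsPrime :=
    Ideal.map_isPrime_of_surjective Ideal.Quotient.mk_surjective (hker _ (h₀.trans h₁).le)
  have hQcomap : Q.comap (Ideal.Quotient.mk p₀) = q := hcomap q (h₀.trans h₁).le
  let S := Localization.AtPrime Q
  have : IsNoetherianRing S := IsLocalization.isNoetherianRing Q.primeCompl S inferInstance
  have : IsDomain S := IsLocalization.isDomain_localization Q.primeCompl_le_nonZeroDivisors
  let f : R →+* S := (algebraMap (R ⧸ p₀) S).comp (Ideal.Quotient.mk p₀)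
  have hfm : (IsLocalRing.maximalIdeal S).comap f = q := by
    rw [← Ideal.comap_comap]
    exact (congrArg _ (Localization.AtPrime.under_maximalIdeal (I := Q))).trans hQcomap
  have hm : IsLocalRing.maximalIdeal S ∈ (Ideal.span {f u, f v}).minimalPrimes := by
    have hspan : ∀ P : Ideal S, Ideal.span {f u, f v} ≤ P ↔ Ideal.span {u, v} ≤ P.comap f :=
      fun P ↦ by
        simp only [Ideal.span_le, Set.insert_subset_iff, Set.singleton_subset_iff]
        rfl
    refine ⟨⟨inferInstance, (hspan _).mpr (hfm ▸ hq.1.2)⟩, ?_⟩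
    rintro P ⟨hP, hPuv⟩ hPm
    have h := hq.2 ⟨hP.comap f, (hspan P).mp hPuv⟩ ((Ideal.comap_mono hPm).trans hfm.le)
    rw [← Localization.AtPrime.map_eq_maximalIdeal, Ideal.map_le_iff_le_comap,
      Ideal.map_le_iff_le_comap]
    exact h
  have hht : 1 < (IsLocalRing.maximalIdeal S).height := by
    have hQ₁ : (p₁.map (Ideal.Quotient.mk p₀)).IsPrime :=
      Ideal.map_isPrime_of_surjective Ideal.Quotient.mk_surjective (hker _ h₀.le)
    have hlt₁ : p₁.map (Ideal.Quotient.mk p₀) < Q :=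
      lt_of_le_of_ne (Ideal.map_mono h₁.le) fun h ↦
        h₁.ne (by rw [← hcomap p₁ h₀.le, h, hQcomap])
    have hlt₀ : ⊥ < p₁.map (Ideal.Quotient.mk p₀) := bot_lt_iff_ne_bot.mpr fun h ↦
      h₀.not_ge <| by rw [← hcomap p₁ h₀.le, h, ← RingHom.ker_eq_comap_bot, Ideal.mk_ker]
    have h : (IsLocalRing.maximalIdeal S).height = Q.height := by
      rw [← WithBot.coe_inj, ← IsLocalization.AtPrime.ringKrullDim_eq_height Q S,
        IsLocalRing.maximalIdeal_height_eq_ringKrullDim]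
    calc (1 : ℕ∞) < 0 + 1 + 1 := by norm_num
      _ ≤ (⊥ : Ideal (R ⧸ p₀)).height + 1 + 1 := by gcongr; exact zero_le
      _ ≤ (p₁.map (Ideal.Quotient.mk p₀)).height + 1 := by
        gcongr
        exact Ideal.height_add_one_le_of_lt_of_isPrime hlt₀
      _ ≤ Q.height := Ideal.height_add_one_le_of_lt_of_isPrime hlt₁
      _ = _ := h.symm
  have hfw : IsUnit (f w) := by
    by_contra hn
    exact hw (hfm ▸ (IsLocalRing.mem_maximalIdeal _).mpr hn)
  obtain ⟨a, b, hab⟩ := Ideal.mem_span_pair.mp hmem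
  obtain ⟨y, hy⟩ := hfw.exists_left_inv
  refine mul_pow_ne_add_of_one_lt_height hm hht t (y * f a) (y * f b) ?_
  have h := congrArg (fun z ↦ y * f z) hab
  simp only [map_add, map_mul, map_pow] at h
  linear_combination -h - (f u * f v) ^ t * hy

/-- If every element of `J` kills all the classes `1 / (u v) ^ (s + 1)` in the second local cohomology
of `R` with respect to `(u, v)`, then `(R ⧸ J)_q` has dimension at least two for each minimal prime
`q` of `(u, v)` of height at least two. -/
theorem Ideal.exists_lt_lt_of_mem_minimalPrimes {R : Type*} [CommRing R]
    [IsNoetherianRing R] {J q p₀ p₁ : Ideal R} [p₀.IsPrime] [p₁.IsPrime] {u v : R}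
    (hq : q ∈ (Ideal.span {u, v}).minimalPrimes) (h₀ : p₀ < p₁) (h₁ : p₁ < q)
    (hJ : ∀ c ∈ J, ∀ s : ℕ, c * (u * v) ^ s ∈ Ideal.span {u ^ (2 * s + 1), v ^ (2 * s + 1)}) :
    ∃ P₀ P₁ : Ideal R, P₀.IsPrime ∧ P₁.IsPrime ∧ J ≤ P₀ ∧ P₀ < P₁ ∧ P₁ < q := by
  by_contra! H
  have hqp : q.IsPrime := hq.1.1
  obtain ⟨w, hw, t, a, c, hc, h⟩ := Ideal.exists_mul_pow_mem_of_forall_not_lt (J := J) (u := u)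
    (hq.1.2 (Ideal.subset_span (by simp)) : v ∈ q) H
  refine Ideal.mul_mul_pow_notMem_span_of_mem_minimalPrimes hq h₀ h₁ hw (2 * t) ?_
  have hu : w * (u * v) ^ (2 * t) = a * v ^ t * u ^ (2 * t + 1) + c * (u * v) ^ t := by
    linear_combination (u * v) ^ t * h
  rw [hu]
  exact add_mem (Ideal.mul_mem_left _ _ (Ideal.subset_span (by simp))) (hJ c hc t)

/-- If `(R ⧸ J)_q` has dimension at least two for every minimal prime `q` of `(u, v) ⊇ J`, then
`R ⧸ J` has full dimension, since killing `u` and `v` lowers the dimension by at most two. -/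
theorem ringKrullDim_le_ringKrullDim_quotient_of_forall_minimalPrimes {R : Type*} [CommRing R]
    [IsLocalRing R] [IsNoetherianRing R] {J : Ideal R} {u v : R}
    (huv : Ideal.span {u, v} ≠ ⊤) (hJ : J ≤ Ideal.span {u, v})
    (h : ∀ q ∈ (Ideal.span {u, v}).minimalPrimes,
      ∃ P₀ P₁ : Ideal R, P₀.IsPrime ∧ P₁.IsPrime ∧ J ≤ P₀ ∧ P₀ < P₁ ∧ P₁ < q) :
    ringKrullDim R ≤ ringKrullDim (R ⧸ J) := by
  have hle : ringKrullDim R ≤ ringKrullDim (R ⧸ Ideal.span {u, v}) + 2 := by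
    refine (ringKrullDim_le_ringKrullDim_quotient_add_encard (s := {u, v}) ?_).trans ?_
    · rw [IsLocalRing.ringJacobson_eq_maximalIdeal]
      exact Ideal.span_le.mp (IsLocalRing.le_maximalIdeal huv)
    · gcongr
      have h : ({u, v} : Set R).encard ≤ 2 := (Set.encard_insert_le _ _).trans <| by
        rw [Set.encard_singleton, one_add_one_eq_two]
      exact WithBot.coe_le_coe.mpr h
  refine hle.trans ?_
  have : Nontrivial (R ⧸ Ideal.span {u, v}) := Ideal.Quotient.nontrivial_iff.mpr huv
  have : IsLocalRing (R ⧸ Ideal.span {u, v}) :=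
    .of_surjective' (Ideal.Quotient.mk _) Ideal.Quotient.mk_surjective
  obtain ⟨n, hn⟩ : ∃ n : ℕ, ringKrullDim (R ⧸ Ideal.span {u, v}) = n :=
    ⟨_, Order.krullDim_eq_length_of_finiteDimensionalOrder⟩
  have hl := hn.ge
  rw [ringKrullDim_quotient, Order.le_krullDim_iff] at hl
  obtain ⟨l, hl⟩ := hl
  have hhead : Ideal.span {u, v} ≤ l.head.1.asIdeal := l.head.2
  obtain ⟨q, hq, hql⟩ := Ideal.exists_minimalPrimes_le hhead
  obtain ⟨P₀, P₁, hP₀, hP₁, hJP, h₀, h₁⟩ := h q hq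
  let x₀ : PrimeSpectrum.zeroLocus (J : Set R) := ⟨⟨P₀, hP₀⟩, hJP⟩
  let x₁ : PrimeSpectrum.zeroLocus (J : Set R) := ⟨⟨P₁, hP₁⟩, hJP.trans h₀.le⟩
  let l' : LTSeries (PrimeSpectrum.zeroLocus (J : Set R)) :=
    l.map (Set.inclusion (PrimeSpectrum.zeroLocus_anti_mono hJ)) fun _ _ h ↦ h
  have hx₁ : x₁ < l'.head := h₁.trans_le hql
  rw [hn, ringKrullDim_quotient]
  exact Order.le_krullDim_iff.mpr ⟨(l'.cons x₁ hx₁).cons x₀ h₀, by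
    change 0 + (0 + l.length + 1) + 1 = n + 2
    lia⟩

theorem bidiagMatrix_mulVec_apply {T : Type} [CommRing T] (u v : T) (n : ℕ) (a : Fin (n + 1) → T)
    (i : Fin n) :
    (bidiagMatrix u v n).mulVec a i = u * a i.castSucc + v * a i.succ := by
  have h : ∀ j : Fin (n + 1), bidiagMatrix u v n i j * a j =
      (if j = i.castSucc then u * a j else 0) + (if j = i.succ then v * a j else 0) := by
    intro j
    simp only [bidiagMatrix, Matrix.of_apply, Fin.ext_iff, Fin.val_castSucc, Fin.val_succ]
    split_ifs <;> first | lia | simp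
  simp [Matrix.mulVec, dotProduct, h, Finset.sum_add_distrib]

theorem mul_pow_mul_pow_mem_span_of_mem_annihilator_bidiagCoker {T : Type} [CommRing T] {u v c : T}
    {n k : ℕ} (hk : k < n) (hc : c ∈ Module.annihilator T (bidiagCoker u v n)) :
    c * (u ^ (n - 1 - k) * v ^ k) ∈ Ideal.span {u ^ n, v ^ n} := by
  have h0 := Module.mem_annihilator.mp hc (Submodule.Quotient.mk (Pi.single ⟨k, hk⟩ 1))
  rw [← Submodule.Quotient.mk_smul, Submodule.Quotient.mk_eq_zero] at h0
  obtain ⟨a, ha⟩ := h0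
  have hrow : ∀ i : Fin n, u * a i.castSucc + v * a i.succ = if i = ⟨k, hk⟩ then c else 0 := by
    intro i
    rw [← bidiagMatrix_mulVec_apply, ← Matrix.mulVecLin_apply, ha]
    simp [Pi.single_apply]
  let g : ℕ → T := fun i ↦ if hi : i < n + 1 then (-1) ^ i * u ^ (n - i) * v ^ i * a ⟨i, hi⟩ else 0
  have hsum : ∑ i : Fin n, (-1) ^ (i : ℕ) * u ^ (n - 1 - i) * v ^ (i : ℕ) *
      (u * a i.castSucc + v * a i.succ) = g 0 - g n := by
    rw [← Finset.sum_range_sub', ← Fin.sum_univ_eq_sum_range (fun i ↦ g i - g (i + 1))]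
    refine Finset.sum_congr rfl fun i _ ↦ ?_
    have hi := i.2
    have h1 : n - i = (n - 1 - i) + 1 := by lia
    have h2 : n - (i + 1) = n - 1 - i := by lia
    simp only [g, show (i : ℕ) < n + 1 by lia, show (i : ℕ) + 1 < n + 1 by lia, dite_true, h1, h2]
    change _ = _ * a i.castSucc - _ * a i.succ
    ring
  simp only [hrow, mul_ite, mul_zero, Finset.sum_ite_eq', Finset.mem_univ, if_true] at hsum
  have h1 : (1 : T) = (-1) ^ k * (-1) ^ k := by rw [← mul_pow]; simp
  refine Ideal.mem_span_pair.mpr ⟨(-1) ^ k * a 0, - (-1) ^ k * (-1) ^ n * a ⟨n, by lia⟩, ?_⟩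
  have hg0 : g 0 = u ^ n * a 0 := by simp [g]
  have hgn : g n = (-1) ^ n * v ^ n * a ⟨n, by lia⟩ := by simp [g]
  rw [hg0, hgn] at hsum
  calc _ = (-1) ^ k * (u ^ n * a 0 - (-1) ^ n * v ^ n * a ⟨n, by lia⟩) := by ring
    _ = ((-1) ^ k * (-1) ^ k) * (c * (u ^ (n - 1 - k) * v ^ k)) := by rw [← hsum]; ring
    _ = _ := by rw [← h1, one_mul]

/-- **Marley–Vassilev, Lemma 2.6.**
Let `(T, m)` be a Noetherian local ring and `u, v ∈ T` with `ht (u,v)T = 2`.  For `n ≥ 1`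
let `M_n` be the cokernel of `φ_n : T^{n+1} → T^n` given by the bidiagonal matrix `A_n`
(diagonal entries `u`, superdiagonal entries `v`), and set `J = ⋂_{n ≥ 1} ann_T M_n`.
Then `dim T/J = dim T`. -/
theorem ringKrullDim_quotient_inf_annihilator_bidiag
    {T : Type} [CommRing T] [IsLocalRing T] [IsNoetherianRing T] (u v : T)
    (hht : idealHeight (Ideal.span {u, v}) = 2) :
    ringKrullDim (T ⧸ (⨅ n : ℕ, Module.annihilator T (bidiagCoker u v (n + 1))))
      = ringKrullDim T := by
  refine le_antisymm (ringKrullDim_quotient_le _) ?_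
  have hJ : ∀ c ∈ ⨅ n : ℕ, Module.annihilator T (bidiagCoker u v (n + 1)), ∀ s : ℕ,
      c * (u * v) ^ s ∈ Ideal.span {u ^ (2 * s + 1), v ^ (2 * s + 1)} := by
    intro c hc s
    have h := mul_pow_mul_pow_mem_span_of_mem_annihilator_bidiagCoker (by lia : s < 2 * s + 1)
      (Submodule.mem_iInf _ |>.mp hc (2 * s))
    rwa [show 2 * s + 1 - 1 - s = s by lia, ← mul_pow] at h
  have hprime : ∀ p : PrimeSpectrum T, Ideal.span {u, v} ≤ p.asIdeal → 1 < Order.height p := by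
    intro p hp
    have h : (2 : ℕ∞) ≤ Order.height p := hht.ge.trans (iInf₂_le p hp)
    exact lt_of_lt_of_le (by norm_num) h
  refine ringKrullDim_le_ringKrullDim_quotient_of_forall_minimalPrimes (u := u) (v := v) ?_
    (fun c hc ↦ by simpa using hJ c hc 0) fun q hq ↦ ?_
  · intro htop
    have h : idealHeight (Ideal.span {u, v}) = ⊤ := by
      exact iInf₂_eq_top.mpr fun p hp ↦ (p.isPrime.ne_top (top_le_iff.mp (htop.ge.trans hp))).elim
    rw [hht] at h
    exact absurd h (by decide)
  · obtain ⟨p₁, p₀, h₀, h₁⟩ := Order.one_lt_height_iff.mp (hprime ⟨q, hq.1.1⟩ hq.1.2)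
    exact Ideal.exists_lt_lt_of_mem_minimalPrimes hq (p₀ := p₀.asIdeal) (p₁ := p₁.asIdeal) h₀ h₁ hJ
end
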